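/- arXiv:1312.7142 — 3 statements merged into one kernel-verified Lean document; each statement's English description precedes it below -/
import Mathlib

section
/- Let p > 0 and a > 0. Let X and Y be independent random variables with X > 0 almost surely and Y distributed as Γ(p, a/2). Then X and 1/(Y + X) have the same distribution if and only if X follows the GIG(−p, a, a) distribution. -/
open MeasureTheory ProbabilityTheory Real Set Filter

/-- Unnormalized density of the GIG(p, a, b) distribution on (0, ∞). -/
noncomputable def gigpdf (p a b : ℝ) (x : ℝ) : ℝ :=
  if 0 < x then x ^ (p - 1) * Real.exp (-(a * x + b / x) / 2) else 0

/-- Unnormalized density of the Gamma distribution with shape p and rate c on (0, ∞). -/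
noncomputable def gampdf (p c : ℝ) (x : ℝ) : ℝ :=
  if 0 < x then x ^ (p - 1) * Real.exp (-(c * x)) else 0

/-- The law of `X` under `μ` has a Lebesgue density proportional to `g`. -/
def HasLawProp {Ω : Type*} [MeasurableSpace Ω] (μ : Measure Ω) (X : Ω → ℝ) (g : ℝ → ℝ) : Prop :=
  ∃ k : ℝ, 0 < k ∧ Measure.map X μ = volume.withDensity (fun x => ENNReal.ofReal (k * g x))

/-- `X` follows the GIG(p, a, b) distribution under `μ`. -/
def HasLawGIG {Ω : Type*} [MeasurableSpace Ω] (μ : Measure Ω) (X : Ω → ℝ) (p a b : ℝ) : Prop :=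
  HasLawProp μ X (gigpdf p a b)

/-- `X` follows the Gamma(p, c) distribution under `μ`. -/
def HasLawGamma {Ω : Type*} [MeasurableSpace Ω] (μ : Measure Ω) (X : Ω → ℝ) (p c : ℝ) : Prop :=
  HasLawProp μ X (gampdf p c)

/-- One step of the random recursion `x ↦ 1 / (Y + x)`, where `Y` has law `γ`, acting on laws. -/
noncomputable def invAddStep (γ ν : Measure ℝ) : Measure ℝ :=
  (ν.prod γ).map fun q => 1 / (q.2 + q.1)

lemma invAddStep_apply (γ ν : Measure ℝ) [SFinite γ] {s : Set ℝ} (hs : MeasurableSet s) :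
    invAddStep γ ν s = ∫⁻ x, γ {y | 1 / (y + x) ∈ s} ∂ν := by
  have hm : Measurable fun q : ℝ × ℝ => 1 / (q.2 + q.1) := by fun_prop
  rw [invAddStep, Measure.map_apply hm hs, Measure.prod_apply (hm hs)]
  rfl

lemma invAddStep_univ (γ ν : Measure ℝ) [IsProbabilityMeasure γ] :
    invAddStep γ ν univ = ν univ := by
  simp [invAddStep_apply]

lemma invAddStep_add (γ ν ν' : Measure ℝ) [SFinite γ] [SFinite ν] [SFinite ν'] :
    invAddStep γ (ν + ν') = invAddStep γ ν + invAddStep γ ν' := by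
  rw [invAddStep, Measure.add_prod, Measure.map_add _ _ (by fun_prop)]
  rfl

lemma invAddStep_mono (γ : Measure ℝ) [SFinite γ] {ν ν' : Measure ℝ} (h : ν ≤ ν') :
    invAddStep γ ν ≤ invAddStep γ ν' :=
  Measure.map_mono (Measure.prod_mono h le_rfl) (by fun_prop)

/-- The positive part of the difference of two stationary laws is stationary. -/
lemma invAddStep_sub_eq (γ ν ρ : Measure ℝ) [IsProbabilityMeasure γ] [IsFiniteMeasure ν]
    [IsFiniteMeasure ρ] (hν : invAddStep γ ν = ν) (hρ : invAddStep γ ρ = ρ) :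
    invAddStep γ (ν - ρ) = ν - ρ := by
  refine (Measure.eq_of_le_of_measure_univ_eq ?_ (invAddStep_univ γ _).symm).symm
  refine Measure.sub_le_of_le_add ?_
  calc ν = invAddStep γ ν := hν.symm
    _ ≤ invAddStep γ (ν - ρ + ρ) := invAddStep_mono γ (Measure.sub_le_iff_le_add.mp le_rfl)
    _ = _ := by rw [invAddStep_add, hρ]

/-- A nonzero stationary law charges a neighbourhood of `0` on the right, seen through
`t ↦ 1 / t`. -/
lemma exists_volume_inter_Ioi_eq_zero (γ α : Measure ℝ) [SFinite γ]
    (hγ : volume.restrict (Ioi 0) ≪ γ) (hα : invAddStep γ α = α) (h0 : α ≠ 0) :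
    ∃ M : ℝ, ∀ s, MeasurableSet s → α s = 0 → volume ({t | 1 / t ∈ s} ∩ Ioi M) = 0 := by
  obtain ⟨n, hn⟩ : ∃ n : ℕ, α (Iio (n : ℝ)) ≠ 0 := by
    by_contra! h
    refine h0 (Measure.measure_univ_eq_zero.mp ?_)
    refine measure_mono_null (fun x _ => ?_) (measure_iUnion_null h)
    exact mem_iUnion.mpr (exists_nat_gt x)
  refine ⟨n, fun s hs hαs => ?_⟩
  have hpre : MeasurableSet {q : ℝ × ℝ | 1 / (q.2 + q.1) ∈ s} :=
    (show Measurable fun q : ℝ × ℝ => 1 / (q.2 + q.1) by fun_prop) hs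
  have hmeas : Measurable fun x => γ {y | 1 / (y + x) ∈ s} := measurable_measure_prodMk_left hpre
  rw [← hα, invAddStep_apply γ α hs, lintegral_eq_zero_iff hmeas] at hαs
  obtain ⟨x, hxn, hx⟩ : ∃ x ∈ Iio (n : ℝ), γ {y | 1 / (y + x) ∈ s} = 0 := by
    by_contra! h
    exact hn (measure_mono_null h hαs)
  have hx' := hγ hx
  rw [Measure.restrict_apply' measurableSet_Ioi] at hx'
  rw [← measure_preimage_add_right volume x]
  refine measure_mono_null ?_ hx'
  rintro y ⟨hy, hyn⟩
  exact ⟨hy, by simp only [mem_Ioi, mem_Iio] at *; linarith⟩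

/-- There is at most one stationary probability law. -/
lemma eq_of_invAddStep_eq (γ ν ρ : Measure ℝ) [IsProbabilityMeasure γ]
    [IsProbabilityMeasure ν] [IsProbabilityMeasure ρ] (hγ : volume.restrict (Ioi 0) ≪ γ)
    (hν : invAddStep γ ν = ν) (hρ : invAddStep γ ρ = ρ) : ν = ρ := by
  by_cases h₁ : ν - ρ = 0
  · refine Measure.eq_of_le_of_measure_univ_eq ?_ (by simp)
    simpa [h₁] using (Measure.sub_le_iff_le_add (μ := ν) (ν := ρ) (ξ := ν - ρ)).mp le_rfl
  by_cases h₂ : ρ - ν = 0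
  · refine (Measure.eq_of_le_of_measure_univ_eq ?_ (by simp)).symm
    simpa [h₂] using (Measure.sub_le_iff_le_add (μ := ρ) (ν := ν) (ξ := ρ - ν)).mp le_rfl
  exfalso
  obtain ⟨M, hM⟩ := exists_volume_inter_Ioi_eq_zero γ _ hγ (invAddStep_sub_eq γ ν ρ hν hρ) h₁
  obtain ⟨N, hN⟩ := exists_volume_inter_Ioi_eq_zero γ _ hγ (invAddStep_sub_eq γ ρ ν hρ hν) h₂
  obtain ⟨s, hs, hs₁, hs₂⟩ := Measure.mutually_singular_measure_sub (μ := ν) (ν := ρ)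
  have h : volume (Ioi (max M N)) = 0 := by
    refine measure_mono_null ?_ (measure_union_null (hM s hs hs₁) (hN sᶜ hs.compl hs₂))
    intro t ht
    rw [mem_Ioi, max_lt_iff] at ht
    by_cases hts : 1 / t ∈ s
    · exact Or.inl ⟨hts, ht.1⟩
    · exact Or.inr ⟨hts, ht.2⟩
  simp at h

lemma lintegral_Ioi_eq_lintegral_inv (F : ℝ → ENNReal) :
    ∫⁻ t in Ioi 0, F t = ∫⁻ z in Ioi 0, ENNReal.ofReal ((z ^ 2)⁻¹) * F (1 / z) := by
  have himg : (fun z : ℝ => z⁻¹) '' Ioi 0 = Ioi 0 := by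
    ext t
    refine ⟨?_, fun ht => ⟨t⁻¹, mem_Ioi.mpr (inv_pos.mpr ht), inv_inv t⟩⟩
    rintro ⟨z, hz, rfl⟩
    exact mem_Ioi.mpr (inv_pos.mpr (mem_Ioi.mp hz))
  have h := lintegral_image_eq_lintegral_abs_deriv_mul (s := Ioi (0 : ℝ)) measurableSet_Ioi
    (fun z hz => (hasDerivAt_inv (ne_of_gt hz)).hasDerivWithinAt) inv_injective.injOn F
  rw [himg] at h
  simpa [abs_inv] using h

lemma measurable_gigpdf (p a b : ℝ) : Measurable (gigpdf p a b) :=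
  Measurable.ite measurableSet_Ioi (by fun_prop) measurable_const

lemma measurable_gampdf (p c : ℝ) : Measurable (gampdf p c) :=
  Measurable.ite measurableSet_Ioi (by fun_prop) measurable_const

lemma gigpdf_nonneg (p a b x : ℝ) : 0 ≤ gigpdf p a b x := by
  unfold gigpdf; split_ifs <;> positivity

/-- Detailed balance: the GIG density is reversible for the transition density of
`x ↦ 1 / (Y + x)`. -/
lemma gigpdf_mul_gampdf_symm (p a : ℝ) {x z : ℝ} (hx : 0 < x) (hz : 0 < z) :
    gigpdf (-p) a a x * (gampdf p (a / 2) (1 / z - x) * (z ^ 2)⁻¹) =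
      gigpdf (-p) a a z * (gampdf p (a / 2) (1 / x - z) * (x ^ 2)⁻¹) := by
  have key : ∀ {x z : ℝ}, 0 < x → 0 < z → x * z < 1 →
      gigpdf (-p) a a x * (gampdf p (a / 2) (1 / z - x) * (z ^ 2)⁻¹) =
        (x * z) ^ (-p - 1) * (1 - x * z) ^ (p - 1) * exp (-(a / x + a / z) / 2) := by
    intro x z hx hz hxz
    have h1 : 1 / z - x = (1 - x * z) * z⁻¹ := by field_simp
    have hpos : 0 < 1 - x * z := by linarith
    have hpos' : 0 < 1 / z - x := by rw [h1]; positivity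
    have hE : exp (-(a * x + a / x) / 2) * exp (-(a / 2 * (1 / z - x))) =
        exp (-(a / x + a / z) / 2) := by
      rw [← exp_add]; congr 1; field_simp; ring
    have hz2 : (z⁻¹) ^ (p - 1) * (z ^ 2)⁻¹ = z ^ (-p - 1) := by
      rw [inv_rpow hz.le, ← rpow_neg hz.le, ← rpow_natCast, ← rpow_neg hz.le, ← rpow_add hz]
      congr 1; push_cast; ring
    rw [gigpdf, gampdf, if_pos hx, if_pos hpos', ← hE, mul_rpow hx.le hz.le, ← hz2, h1,
      mul_rpow hpos.le (by positivity)]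
    ring
  rcases lt_or_ge (x * z) 1 with h | h
  · rw [key hx hz h, key hz hx (by linarith), mul_comm z x, add_comm (a / x)]
  · have h1 : ¬ 0 < 1 / z - x := by
      rw [not_lt, sub_nonpos, div_le_iff₀ hz]; exact h
    have h2 : ¬ 0 < 1 / x - z := by
      rw [not_lt, sub_nonpos, div_le_iff₀ hx]; linarith
    rw [gampdf, gampdf, if_neg h1, if_neg h2]
    simp

/-- The transition density of `x ↦ 1 / (Y + x)`. -/
lemma withDensity_gampdf_apply_inv_add (p c k : ℝ) {x : ℝ} (hx : 0 < x) {s : Set ℝ}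
    (hs : MeasurableSet s) :
    volume.withDensity (fun y => ENNReal.ofReal (k * gampdf p c y)) {y | 1 / (y + x) ∈ s} =
      ∫⁻ z in Ioi 0, s.indicator 1 z *
        ENNReal.ofReal (k * (gampdf p c (1 / z - x) * (z ^ 2)⁻¹)) := by
  have hpre : MeasurableSet {y : ℝ | 1 / (y + x) ∈ s} :=
    (show Measurable fun y : ℝ => 1 / (y + x) by fun_prop) hs
  rw [withDensity_apply _ hpre, ← lintegral_indicator hpre,
    ← lintegral_sub_right_eq_self _ x, ← setLIntegral_eq_of_support_subset (s := Ioi 0),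
    lintegral_Ioi_eq_lintegral_inv]
  · refine setLIntegral_congr_fun measurableSet_Ioi fun z _ => ?_
    by_cases hzs : z ∈ s
    · simp only [indicator, mem_ofPred_eq, sub_add_cancel, one_div_one_div, hzs, if_true,
        Pi.one_apply, one_mul]
      rw [← ENNReal.ofReal_mul (by positivity)]
      congr 1; ring
    · simp [indicator, hzs]
  · intro t ht
    by_contra h
    apply ht
    have : ¬ 0 < t - x := by simp only [mem_Ioi] at h; linarith
    simp [indicator, gampdf, this]

lemma lintegral_withDensity_gigpdf (p a b c : ℝ) {f : ℝ → ENNReal} (hf : Measurable f) :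
    ∫⁻ x, f x ∂volume.withDensity (fun x => ENNReal.ofReal (c * gigpdf p a b x)) =
      ∫⁻ x in Ioi 0, ENNReal.ofReal (c * gigpdf p a b x) * f x := by
  have hg := measurable_gigpdf p a b
  rw [lintegral_withDensity_eq_lintegral_mul _ (by fun_prop) hf,
    ← setLIntegral_eq_of_support_subset (s := Ioi 0)]
  · rfl
  · intro x hx
    by_contra h
    apply hx
    have h' : ¬ 0 < x := h
    simp [gigpdf, h']

/-- Every multiple of the GIG law is stationary. -/
lemma invAddStep_gig (p a k c : ℝ) (hc : 0 ≤ c)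
    [IsProbabilityMeasure
      (volume.withDensity fun y => ENNReal.ofReal (k * gampdf p (a / 2) y))] :
    invAddStep (volume.withDensity fun y => ENNReal.ofReal (k * gampdf p (a / 2) y))
      (volume.withDensity fun x => ENNReal.ofReal (c * gigpdf (-p) a a x)) =
      volume.withDensity fun x => ENNReal.ofReal (c * gigpdf (-p) a a x) := by
  have hgam := measurable_gampdf p (a / 2)
  have hgig := measurable_gigpdf (-p) a a
  set γ := volume.withDensity fun y => ENNReal.ofReal (k * gampdf p (a / 2) y) with hγ
  set d : ℝ → ℝ → ENNReal := fun x z =>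
    ENNReal.ofReal (k * (gampdf p (a / 2) (1 / z - x) * (z ^ 2)⁻¹)) with hd
  have hdm : Measurable (Function.uncurry d) := by
    simp only [hd, Function.uncurry_def]; fun_prop
  have hd1 : ∀ x ∈ Ioi (0 : ℝ), ∫⁻ z in Ioi 0, d x z = 1 := by
    intro x hx
    have h := withDensity_gampdf_apply_inv_add p (a / 2) k hx MeasurableSet.univ
    simpa [← hγ, hd] using h.symm
  have hsymm : ∀ x ∈ Ioi (0 : ℝ), ∀ z ∈ Ioi (0 : ℝ),
      ENNReal.ofReal (c * gigpdf (-p) a a x) * d x z =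
        ENNReal.ofReal (c * gigpdf (-p) a a z) * d z x := by
    intro x hx z hz
    rw [hd, ← ENNReal.ofReal_mul (mul_nonneg hc (gigpdf_nonneg ..)),
      ← ENNReal.ofReal_mul (mul_nonneg hc (gigpdf_nonneg ..))]
    congr 1
    linear_combination c * k * gigpdf_mul_gampdf_symm p a hx hz
  ext s hs
  have hpre : MeasurableSet {q : ℝ × ℝ | 1 / (q.2 + q.1) ∈ s} :=
    (show Measurable fun q : ℝ × ℝ => 1 / (q.2 + q.1) by fun_prop) hs
  have hmeas : Measurable fun x => γ {y | 1 / (y + x) ∈ s} := measurable_measure_prodMk_left hpre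
  have hind : Measurable (s.indicator (1 : ℝ → ENNReal)) := measurable_one.indicator hs
  rw [invAddStep_apply _ _ hs, lintegral_withDensity_gigpdf _ _ _ _ hmeas,
    ← lintegral_indicator_one hs, lintegral_withDensity_gigpdf _ _ _ _ hind]
  calc ∫⁻ x in Ioi 0, ENNReal.ofReal (c * gigpdf (-p) a a x) * γ {y | 1 / (y + x) ∈ s}
      = ∫⁻ x in Ioi 0, ∫⁻ z in Ioi 0,
          ENNReal.ofReal (c * gigpdf (-p) a a x) * (s.indicator 1 z * d x z) := by
        refine setLIntegral_congr_fun measurableSet_Ioi fun x hx => ?_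
        rw [hγ, withDensity_gampdf_apply_inv_add p (a / 2) k hx hs,
          lintegral_const_mul _ (by fun_prop)]
    _ = ∫⁻ z in Ioi 0, ∫⁻ x in Ioi 0,
          ENNReal.ofReal (c * gigpdf (-p) a a x) * (s.indicator 1 z * d x z) := by
        refine lintegral_lintegral_swap (Measurable.aemeasurable ?_)
        simp only [Function.uncurry_def] at hdm ⊢
        fun_prop
    _ = ∫⁻ z in Ioi 0, ENNReal.ofReal (c * gigpdf (-p) a a z) * s.indicator 1 z := by
        refine setLIntegral_congr_fun measurableSet_Ioi fun z hz => ?_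
        have hdz : Measurable (d z) := by fun_prop
        rw [← mul_one (ENNReal.ofReal _ * _), ← hd1 z hz, ← lintegral_const_mul _ hdz]
        refine setLIntegral_congr_fun measurableSet_Ioi fun x hx => ?_
        rw [mul_left_comm, hsymm x hx z hz]
        ring

lemma lintegral_gigpdf_lt_top (p a k : ℝ) (ha : 0 < a) (hk : 0 < k)
    (h : ∫⁻ y, ENNReal.ofReal (k * gampdf p (a / 2) y) ≠ ⊤) :
    ∫⁻ x in Ioi 0, ENNReal.ofReal (gigpdf (-p) a a x) < ⊤ := by
  have hk' : ENNReal.ofReal k ≠ 0 := by simpa using hk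
  have hgam := measurable_gampdf p (a / 2)
  simp_rw [ENNReal.ofReal_mul hk.le] at h
  rw [lintegral_const_mul _ (by fun_prop)] at h
  refine lt_of_le_of_lt ?_ (ENNReal.lt_top_of_mul_ne_top_right h hk')
  rw [lintegral_Ioi_eq_lintegral_inv]
  refine le_trans ?_ (setLIntegral_le_lintegral (Ioi 0) _)
  refine setLIntegral_mono' measurableSet_Ioi fun u (hu : 0 < u) => ?_
  rw [← ENNReal.ofReal_mul (by positivity)]
  refine ENNReal.ofReal_le_ofReal ?_
  have hpow : (u ^ 2)⁻¹ * (1 / u) ^ (-p - 1) = u ^ (p - 1) := by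
    rw [one_div, inv_rpow hu.le, ← rpow_neg hu.le, ← rpow_natCast, ← rpow_neg hu.le,
      ← rpow_add hu]
    congr 1; push_cast; ring
  rw [gigpdf, gampdf, if_pos hu, if_pos (by positivity), ← mul_assoc, hpow]
  have : 0 ≤ a * (1 / u) := by positivity
  have h2 : a / (1 / u) = a * u := by field_simp
  gcongr
  rw [h2]
  linarith

/-- The GIG density can be normalized to a probability density. -/
lemma exists_isProbabilityMeasure_gig (p a : ℝ)
    (h : ∫⁻ x in Ioi 0, ENNReal.ofReal (gigpdf (-p) a a x) < ⊤) :
    ∃ c : ℝ, 0 < c ∧ IsProbabilityMeasure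
      (volume.withDensity fun x => ENNReal.ofReal (c * gigpdf (-p) a a x)) := by
  have hgig := measurable_gigpdf (-p) a a
  set I := ∫⁻ x in Ioi 0, ENNReal.ofReal (gigpdf (-p) a a x) with hI
  have hI0 : I ≠ 0 := by
    rw [← pos_iff_ne_zero, hI, setLIntegral_pos_iff (by fun_prop)]
    refine lt_of_lt_of_le (by simp : (0 : ENNReal) < volume (Ioi (0 : ℝ))) (measure_mono ?_)
    intro x (hx : 0 < x)
    refine ⟨?_, hx⟩
    simp only [Function.mem_support, ne_eq, ENNReal.ofReal_eq_zero, not_le, gigpdf, if_pos hx]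
    positivity
  refine ⟨I.toReal⁻¹, inv_pos.mpr (ENNReal.toReal_pos hI0 h.ne), ⟨?_⟩⟩
  rw [← lintegral_one, lintegral_withDensity_gigpdf _ _ _ _ measurable_const]
  simp_rw [mul_one, ENNReal.ofReal_mul (inv_nonneg.mpr ENNReal.toReal_nonneg)]
  rw [lintegral_const_mul _ (by fun_prop), ← hI,
    ENNReal.ofReal_inv_of_pos (ENNReal.toReal_pos hI0 h.ne), ENNReal.ofReal_toReal h.ne,
    ENNReal.inv_mul_cancel hI0 h.ne]

lemma restrict_Ioi_absolutelyContinuous_gampdf (p c k : ℝ) (hk : 0 < k) :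
    volume.restrict (Ioi 0) ≪
      volume.withDensity fun y => ENNReal.ofReal (k * gampdf p c y) := by
  have hgam := measurable_gampdf p c
  intro s hs
  rw [withDensity_apply_eq_zero (by fun_prop)] at hs
  rw [Measure.restrict_apply' measurableSet_Ioi]
  refine measure_mono_null ?_ hs
  rintro x ⟨hxs, hx : 0 < x⟩
  refine ⟨?_, hxs⟩
  simp only [mem_ofPred_eq, ne_eq, ENNReal.ofReal_eq_zero, not_le, gampdf, if_pos hx]
  positivity

/-- Letac–Seshadri: `X =_d 1/(Y+X)` iff `X ~ GIG(-p, a, a)`, for `X ⟂ Y`, `Y ~ Γ(p, a/2)`. -/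
theorem gig_continued_fraction_fixed_point
    {Ω : Type*} [MeasurableSpace Ω] (μ : Measure Ω) [IsProbabilityMeasure μ]
    (p a : ℝ) (hp : 0 < p) (ha : 0 < a)
    (X Y : Ω → ℝ) (hXm : Measurable X) (hYm : Measurable Y)
    (hXpos : ∀ᵐ ω ∂μ, 0 < X ω)
    (hindep : IndepFun X Y μ)
    (hY : HasLawGamma μ Y p (a / 2)) :
    Measure.map X μ = Measure.map (fun ω => 1 / (Y ω + X ω)) μ ↔ HasLawGIG μ X (-p) a a := by
  obtain ⟨k, hk, hYk⟩ := hY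
  have hνp : IsProbabilityMeasure (μ.map X) := Measure.isProbabilityMeasure_map hXm.aemeasurable
  have hγp : IsProbabilityMeasure (μ.map Y) := Measure.isProbabilityMeasure_map hYm.aemeasurable
  have hstep : μ.map (fun ω => 1 / (Y ω + X ω)) = invAddStep (μ.map Y) (μ.map X) := by
    rw [invAddStep, ← (indepFun_iff_map_prod_eq_prod_map_map hXm.aemeasurable
      hYm.aemeasurable).mp hindep, Measure.map_map (by fun_prop) (by fun_prop)]
    rfl
  rw [hstep]
  rw [hYk] at hγp ⊢
  constructor
  · intro h
    have hfin := measure_ne_top (volume.withDensity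
      fun y => ENNReal.ofReal (k * gampdf p (a / 2) y)) univ
    rw [withDensity_apply _ MeasurableSet.univ, Measure.restrict_univ] at hfin
    obtain ⟨c, hc, hρ⟩ :=
      exists_isProbabilityMeasure_gig p a (lintegral_gigpdf_lt_top p a k ha hk hfin)
    exact ⟨c, hc, eq_of_invAddStep_eq _ _ _
      (restrict_Ioi_absolutelyContinuous_gampdf p (a / 2) k hk) h.symm
      (invAddStep_gig p a k c hc.le)⟩
  · rintro ⟨c, hc, h⟩
    rw [h]
    exact (invAddStep_gig p a k c hc.le).symm
end

section
/- (Matsumoto–Yor property.) Let p, a, b > 0 and let X and Y be independent random variables with X distributed as GIG(−p, a, b) and Y distributed as Γ(p, a/2). Then the random variables U = 1/(X + Y) and V = 1/X − 1/(X + Y) are independent. -/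
open MeasureTheory ProbabilityTheory Real Set Filter

/-- Change of variables for a map which is an involution of a set carrying the density. -/
lemma map_withDensity_of_involutiveOn {E : Type*} [NormedAddCommGroup E] [NormedSpace ℝ E]
    [FiniteDimensional ℝ E] [MeasurableSpace E] [BorelSpace E] (ν : Measure E)
    [ν.IsAddHaarMeasure] {S : Set E} (hS : MeasurableSet S) {f : E → E} {f' : E → E →L[ℝ] E}
    (hf : Measurable f) (hmaps : MapsTo f S S) (hinv : LeftInvOn f f S)
    (hf' : ∀ x ∈ S, HasFDerivWithinAt f (f' x) S x) {G H : E → ENNReal}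
    (hG : ∀ x ∉ S, G x = 0) (hH : ∀ x ∉ S, H x = 0)
    (hGH : ∀ x ∈ S, ENNReal.ofReal |(f' x).det| * G (f x) = H x) :
    (ν.withDensity G).map f = ν.withDensity H := by
  have restrict_support : ∀ (A : Set E) (F : E → ENNReal), (∀ x ∉ S, F x = 0) →
      ∫⁻ x in A, F x ∂ν = ∫⁻ x in A ∩ S, F x ∂ν := by
    intro A F hF
    have hF' : F = S.indicator F := by
      ext x
      by_cases hx : x ∈ S <;> simp [hx, hF]
    rw [hF', setLIntegral_indicator hS, setLIntegral_indicator hS, inter_comm A S, ← inter_assoc,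
      inter_self]
  ext A hA
  have himage : f ⁻¹' A ∩ S = f '' (A ∩ S) := by
    ext x
    constructor
    · rintro ⟨hx, hxS⟩
      exact ⟨f x, ⟨hx, hmaps hxS⟩, hinv hxS⟩
    · rintro ⟨y, ⟨hy, hyS⟩, rfl⟩
      exact ⟨by rwa [mem_preimage, hinv hyS], hmaps hyS⟩
  rw [Measure.map_apply hf hA, withDensity_apply _ (hf hA), withDensity_apply _ hA,
    restrict_support _ G hG, restrict_support _ H hH, himage,
    lintegral_image_eq_lintegral_abs_det_fderiv_mul ν (hA.inter hS)
      (fun x hx => (hf' x hx.2).mono inter_subset_right)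
      (hinv.injOn.mono inter_subset_right)]
  exact setLIntegral_congr_fun (hA.inter hS) fun x hx => hGH x hx.2

/-- If the joint law is a product of two measures, not necessarily the marginals, then the
variables are independent. -/
lemma indepFun_of_map_prodMk_eq_prod {Ω α β : Type*} [MeasurableSpace Ω] [MeasurableSpace α]
    [MeasurableSpace β] {μ : Measure Ω} [IsProbabilityMeasure μ] {U : Ω → α} {V : Ω → β}
    (hU : Measurable U) (hV : Measurable V) (ρ : Measure α) (σ : Measure β) [SFinite ρ]
    [SFinite σ] (h : μ.map (fun ω => (U ω, V ω)) = ρ.prod σ) : IndepFun U V μ := by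
  have key : ∀ A B, MeasurableSet A → MeasurableSet B → μ (U ⁻¹' A ∩ V ⁻¹' B) = ρ A * σ B := by
    intro A B hA hB
    rw [← Measure.prod_prod, ← h, Measure.map_apply (hU.prodMk hV) (hA.prod hB)]
    rfl
  have hone : ρ univ * σ univ = 1 := by
    rw [← key _ _ .univ .univ]
    simp
  rw [indepFun_iff_measure_inter_preimage_eq_mul]
  intro A B hA hB
  have hUA : μ (U ⁻¹' A) = ρ A * σ univ := by
    rw [← key _ _ hA .univ]
    simp
  have hVB : μ (V ⁻¹' B) = ρ univ * σ B := by
    rw [← key _ _ .univ hB]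
    simp
  rw [key _ _ hA hB, hUA, hVB]
  calc ρ A * σ B = ρ A * σ B * (ρ univ * σ univ) := by rw [hone, mul_one]
    _ = _ := by ring

/-- The map `(x, y) ↦ (1 / (x + y), 1 / x - 1 / (x + y))`, an involution of the open positive
quadrant. -/
noncomputable def matsumotoYorMap (z : ℝ × ℝ) : ℝ × ℝ :=
  (1 / (z.1 + z.2), 1 / z.1 - 1 / (z.1 + z.2))

/-- The derivative of `matsumotoYorMap`. -/
noncomputable def matsumotoYorDeriv (z : ℝ × ℝ) : ℝ × ℝ →L[ℝ] ℝ × ℝ :=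
  ((-((z.1 + z.2) ^ 2)⁻¹) •
      (ContinuousLinearMap.fst ℝ ℝ ℝ + ContinuousLinearMap.snd ℝ ℝ ℝ)).prod
    ((-(z.1 ^ 2)⁻¹) • ContinuousLinearMap.fst ℝ ℝ ℝ - (-((z.1 + z.2) ^ 2)⁻¹) •
      (ContinuousLinearMap.fst ℝ ℝ ℝ + ContinuousLinearMap.snd ℝ ℝ ℝ))

lemma measurable_matsumotoYorMap : Measurable matsumotoYorMap := by
  unfold matsumotoYorMap
  fun_prop

lemma mapsTo_matsumotoYorMap :
    MapsTo matsumotoYorMap (Ioi 0 ×ˢ Ioi 0) (Ioi 0 ×ˢ Ioi 0) := by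
  rintro ⟨x, y⟩ ⟨hx : 0 < x, hy : 0 < y⟩
  refine ⟨?_, ?_⟩
  · change 0 < 1 / (x + y)
    positivity
  · exact sub_pos.2 (one_div_lt_one_div_of_lt hx (lt_add_of_pos_right x hy))

lemma leftInvOn_matsumotoYorMap :
    LeftInvOn matsumotoYorMap matsumotoYorMap (Ioi 0 ×ˢ Ioi 0) := by
  rintro ⟨x, y⟩ ⟨hx : 0 < x, hy : 0 < y⟩
  have hxy : 0 < x + y := add_pos hx hy
  simp [matsumotoYorMap]

lemma hasFDerivAt_matsumotoYorMap {z : ℝ × ℝ} (hz : z ∈ Ioi (0 : ℝ) ×ˢ Ioi (0 : ℝ)) :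
    HasFDerivAt matsumotoYorMap (matsumotoYorDeriv z) z := by
  obtain ⟨hx : 0 < z.1, hy : 0 < z.2⟩ := hz
  have hsum : HasFDerivAt (fun w : ℝ × ℝ => 1 / (w.1 + w.2))
      ((-((z.1 + z.2) ^ 2)⁻¹) •
        (ContinuousLinearMap.fst ℝ ℝ ℝ + ContinuousLinearMap.snd ℝ ℝ ℝ)) z := by
    simp only [one_div]
    exact (hasDerivAt_inv (add_pos hx hy).ne').comp_hasFDerivAt z
      (hasFDerivAt_fst.add hasFDerivAt_snd)
  have hfst : HasFDerivAt (fun w : ℝ × ℝ => 1 / w.1)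
      ((-(z.1 ^ 2)⁻¹) • ContinuousLinearMap.fst ℝ ℝ ℝ) z := by
    simp only [one_div]
    exact (hasDerivAt_inv hx.ne').comp_hasFDerivAt z hasFDerivAt_fst
  exact hsum.prodMk (hfst.sub hsum)

lemma det_matsumotoYorDeriv (z : ℝ × ℝ) :
    (matsumotoYorDeriv z).det = -((z.1 ^ 2)⁻¹ * ((z.1 + z.2) ^ 2)⁻¹) := by
  rw [ContinuousLinearMap.det, ← LinearMap.det_toMatrix (Module.Basis.finTwoProd ℝ),
    Matrix.det_fin_two]
  simp [LinearMap.toMatrix_apply, matsumotoYorDeriv]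
  ring

lemma gigpdf_mul_gampdf_matsumotoYorMap (p a b : ℝ) {u v : ℝ} (hu : 0 < u) (hv : 0 < v) :
    |(matsumotoYorDeriv (u, v)).det| * (gigpdf (-p) a b (matsumotoYorMap (u, v)).1 *
        gampdf p (a / 2) (matsumotoYorMap (u, v)).2) =
      gigpdf (-p) b a u * gampdf p (b / 2) v := by
  have hs : 0 < u + v := add_pos hu hv
  have hy : 1 / u - 1 / (u + v) = v / (u * (u + v)) := by
    field_simp
    ring
  have hdet : |(matsumotoYorDeriv (u, v)).det| = (u ^ 2)⁻¹ * ((u + v) ^ 2)⁻¹ := by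
    rw [det_matsumotoYorDeriv, abs_neg, abs_of_pos (by positivity)]
  have hexp : rexp (-(a * (1 / (u + v)) + b / (1 / (u + v))) / 2) *
      rexp (-(a / 2 * (v / (u * (u + v))))) =
      rexp (-(b * u + a / u) / 2) * rexp (-(b / 2 * v)) := by
    rw [← Real.exp_add, ← Real.exp_add]
    congr 1
    field_simp
    ring
  have hpow : (u ^ 2)⁻¹ * ((u + v) ^ 2)⁻¹ *
      ((1 / (u + v)) ^ (-p - 1) * (v / (u * (u + v))) ^ (p - 1)) =
      u ^ (-p - 1) * v ^ (p - 1) := by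
    rw [Real.div_rpow hv.le (by positivity), Real.mul_rpow hu.le hs.le, one_div,
      Real.inv_rpow hs.le, Real.rpow_sub hu, Real.rpow_sub hu, Real.rpow_sub hs, Real.rpow_sub hs,
      Real.rpow_neg hu.le, Real.rpow_neg hs.le, Real.rpow_one, Real.rpow_one]
    have := Real.rpow_pos_of_pos hu p
    have := Real.rpow_pos_of_pos hs p
    field_simp
  simp only [matsumotoYorMap, hy, hdet]
  rw [gigpdf, gampdf, gigpdf, gampdf, if_pos (by positivity), if_pos (by positivity), if_pos hu,
    if_pos hv]
  linear_combination
    (rexp (-(a * (1 / (u + v)) + b / (1 / (u + v))) / 2) *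
      rexp (-(a / 2 * (v / (u * (u + v)))))) * hpow + (u ^ (-p - 1) * v ^ (p - 1)) * hexp

/-- The Matsumoto–Yor property: if `X ~ GIG(-p, a, b)` and `Y ~ Γ(p, a/2)` are independent,
then `U = 1/(X+Y)` and `V = 1/X - 1/(X+Y)` are independent. -/
theorem matsumoto_yor_property
    {Ω : Type*} [MeasurableSpace Ω] (μ : Measure Ω) [IsProbabilityMeasure μ]
    (p a b : ℝ) (hp : 0 < p) (ha : 0 < a) (hb : 0 < b)
    (X Y : Ω → ℝ) (hXm : Measurable X) (hYm : Measurable Y)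
    (hindep : IndepFun X Y μ)
    (hX : HasLawGIG μ X (-p) a b) (hY : HasLawGamma μ Y p (a / 2)) :
    IndepFun (fun ω => 1 / (X ω + Y ω))
      (fun ω => 1 / X ω - 1 / (X ω + Y ω)) μ := by
  obtain ⟨k, hk, hX⟩ := hX
  obtain ⟨l, hl, hY⟩ := hY
  have hm1 (c d : ℝ) : Measurable fun x => ENNReal.ofReal (k * gigpdf (-p) c d x) :=
    ((measurable_gigpdf _ _ _).const_mul k).ennreal_ofReal
  have hm2 (c : ℝ) : Measurable fun x => ENNReal.ofReal (l * gampdf p c x) :=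
    ((measurable_gampdf _ _).const_mul l).ennreal_ofReal
  refine indepFun_of_map_prodMk_eq_prod (by fun_prop) (by fun_prop)
    (volume.withDensity fun x => ENNReal.ofReal (k * gigpdf (-p) b a x))
    (volume.withDensity fun x => ENNReal.ofReal (l * gampdf p (b / 2) x)) ?_
  have hXY := hindep.map_prod_eq_prod_map_map hXm.aemeasurable hYm.aemeasurable
  rw [hX, hY, prod_withDensity (hm1 a b) (hm2 (a / 2))] at hXY
  rw [prod_withDensity (hm1 b a) (hm2 (b / 2))]
  have hcomp : (fun ω => (1 / (X ω + Y ω), 1 / X ω - 1 / (X ω + Y ω))) =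
      matsumotoYorMap ∘ fun ω => (X ω, Y ω) := rfl
  rw [hcomp, ← Measure.map_map measurable_matsumotoYorMap (hXm.prodMk hYm), hXY]
  have hzero (c d e : ℝ) (z : ℝ × ℝ) (hz : z ∉ Ioi (0 : ℝ) ×ˢ Ioi (0 : ℝ)) :
      ENNReal.ofReal (k * gigpdf (-p) c d z.1) * ENNReal.ofReal (l * gampdf p e z.2) = 0 := by
    rw [mem_prod, not_and_or] at hz
    rcases hz with h | h
    · simp [gigpdf, if_neg (show ¬ 0 < z.1 from h)]
    · simp [gampdf, if_neg (show ¬ 0 < z.2 from h)]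
  refine map_withDensity_of_involutiveOn (volume.prod volume)
    (measurableSet_Ioi.prod measurableSet_Ioi) measurable_matsumotoYorMap
    mapsTo_matsumotoYorMap leftInvOn_matsumotoYorMap
    (fun z hz => (hasFDerivAt_matsumotoYorMap hz).hasFDerivWithinAt)
    (hzero _ _ _) (hzero _ _ _) ?_
  rintro ⟨u, v⟩ ⟨hu, hv⟩
  rw [← ENNReal.ofReal_mul (mul_nonneg hk.le (gigpdf_nonneg _ _ _ _)),
    ← ENNReal.ofReal_mul (abs_nonneg _),
    ← ENNReal.ofReal_mul (mul_nonneg hk.le (gigpdf_nonneg _ _ _ _))]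
  congr 1
  linear_combination (k * l) * gigpdf_mul_gampdf_matsumotoYorMap p a b hu hv
end

section
/- (Letac–Wesołowski characterization by the Matsumoto–Yor property.) Let X and Y be two independent random variables, each positive almost surely and neither almost surely constant. Then the random variables U = 1/(X + Y) and V = 1/X − 1/(X + Y) are independent if and only if there exist p > 0, a > 0 and b > 0 such that X follows the GIG(−p, a, b) distribution and Y follows the Γ(p, a/2) distribution. -/
open MeasureTheory ProbabilityTheory Real Set Filter

/-- Differentiation of a weighted Laplace transform under the integral sign. -/
lemma hasDerivAt_integral_mul_exp_neg {α : Type*} [MeasurableSpace α] {P : Measure α}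
    {W T : α → ℝ} (hW : Measurable W) (hT : Measurable T) (hT0 : ∀ᵐ ω ∂P, 0 ≤ T ω)
    (hint : ∀ t > 0, Integrable (fun ω => W ω * exp (-(t * T ω))) P) {t : ℝ} (ht : 0 < t) :
    Integrable (fun ω => W ω * T ω * exp (-(t * T ω))) P ∧
      HasDerivAt (fun r => ∫ ω, W ω * exp (-(r * T ω)) ∂P)
        (-∫ ω, W ω * T ω * exp (-(t * T ω)) ∂P) t := by
  have key := hasDerivAt_integral_of_dominated_loc_of_deriv_le (μ := P) (𝕜 := ℝ)
    (F := fun r ω => W ω * exp (-(r * T ω)))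
    (F' := fun r ω => -(W ω * T ω * exp (-(r * T ω)))) (x₀ := t) (s := Ioi (t / 2))
    (bound := fun ω => (4 / t) * |W ω * exp (-(t / 4 * T ω))|)
    (Ioi_mem_nhds (by linarith)) (Eventually.of_forall fun r => by fun_prop) (hint t ht)
    (by fun_prop) ?_ ((hint (t / 4) (by linarith)).abs.const_mul _) ?_
  · rw [← integral_neg]
    exact ⟨by simpa using key.1.neg, key.2⟩
  · filter_upwards [hT0] with ω h0 r hr
    have hr : t / 2 < r := hr
    have h1 : t / 4 * T ω ≤ exp (t / 4 * T ω) := by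
      linarith [add_one_le_exp (t / 4 * T ω)]
    have h2 : T ω ≤ 4 / t * exp (t / 4 * T ω) := by
      have : T ω = 4 / t * (t / 4 * T ω) := by field_simp
      rw [this]
      gcongr
      rw [← this]; exact h1
    have h3 : exp (-(r * T ω)) ≤ exp (-(t / 4 * T ω)) * exp (-(t / 4 * T ω)) := by
      rw [← exp_add]
      apply exp_le_exp.2
      nlinarith
    rw [norm_neg, Real.norm_eq_abs, abs_mul, abs_mul, abs_mul, abs_of_nonneg h0, abs_of_pos (exp_pos _),
      abs_of_pos (exp_pos _)]
    calc |W ω| * T ω * exp (-(r * T ω))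
        ≤ |W ω| * (4 / t * exp (t / 4 * T ω)) *
          (exp (-(t / 4 * T ω)) * exp (-(t / 4 * T ω))) := by gcongr
      _ = 4 / t * (|W ω| * exp (-(t / 4 * T ω))) *
          (exp (t / 4 * T ω) * exp (-(t / 4 * T ω))) := by ring
      _ = 4 / t * (|W ω| * exp (-(t / 4 * T ω))) := by
        rw [← exp_add, add_neg_cancel, exp_zero, mul_one]
  · refine Eventually.of_forall fun ω r _ => ?_
    have h := (((hasDerivAt_id r).mul_const (T ω)).neg.exp).const_mul (W ω)
    convert! h using 1
    simp; ring

lemma integral_pos_of_ae_pos {α : Type*} [MeasurableSpace α] {P : Measure α} [NeZero P]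
    {f : α → ℝ} (hf : ∀ᵐ ω ∂P, 0 < f ω) (hfi : Integrable f P) : 0 < ∫ ω, f ω ∂P := by
  have h0 : 0 ≤ᵐ[P] f := hf.mono fun _ h => h.le
  refine (integral_nonneg_of_ae h0).lt_of_ne fun h => ?_
  have h1 := (integral_eq_zero_iff_of_nonneg_ae h0 hfi).1 h.symm
  obtain ⟨ω, h2, h3⟩ := (hf.and h1).exists
  exact h2.ne' h3

/-- The moments `E[X ^ k * exp (-(s / X + t * X))]`. -/
noncomputable def gigMoment {α : Type*} [MeasurableSpace α] (P : Measure α) (X : α → ℝ)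
    (k : ℤ) (s t : ℝ) : ℝ :=
  ∫ ω, X ω ^ k * exp (-(s * (X ω)⁻¹ + t * X ω)) ∂P

section gigMoment

variable {α : Type*} [MeasurableSpace α] {P : Measure α} {X : α → ℝ}

lemma zpow_mul_exp_ae_eq_right (hX0 : ∀ᵐ ω ∂P, 0 < X ω) (k : ℤ) (s t : ℝ) :
    (fun ω => X ω ^ k * exp (-(s * (X ω)⁻¹)) * X ω * exp (-(t * X ω))) =ᵐ[P]
      fun ω => X ω ^ (k + 1) * exp (-(s * (X ω)⁻¹ + t * X ω)) := by
  filter_upwards [hX0] with ω h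
  rw [zpow_add_one₀ h.ne', neg_add, exp_add]
  ring

lemma zpow_mul_exp_ae_eq_left (hX0 : ∀ᵐ ω ∂P, 0 < X ω) (k : ℤ) (s t : ℝ) :
    (fun ω => X ω ^ k * exp (-(t * X ω)) * (X ω)⁻¹ * exp (-(s * (X ω)⁻¹))) =ᵐ[P]
      fun ω => X ω ^ (k - 1) * exp (-(s * (X ω)⁻¹ + t * X ω)) := by
  filter_upwards [hX0] with ω h
  rw [zpow_sub_one₀ h.ne', neg_add, exp_add]
  ring

variable [IsFiniteMeasure P]

lemma integrable_zpow_mul_exp (hX : Measurable X) (hX0 : ∀ᵐ ω ∂P, 0 < X ω) (k : ℤ) :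
    ∀ s t : ℝ, 0 < s → 0 < t →
      Integrable (fun ω => X ω ^ k * exp (-(s * (X ω)⁻¹ + t * X ω))) P := by
  induction k using Int.induction_on with
  | zero =>
    intro s t hs ht
    refine Integrable.of_bound (by fun_prop) 1 ?_
    filter_upwards [hX0] with ω h
    rw [zpow_zero, one_mul, Real.norm_eq_abs, abs_of_pos (exp_pos _), exp_le_one_iff]
    have := inv_pos.2 h
    nlinarith [mul_pos hs this, mul_pos ht h]
  | succ k ih =>
    intro s t hs ht
    refine (hasDerivAt_integral_mul_exp_neg (W := fun ω => X ω ^ (k : ℤ) * exp (-(s * (X ω)⁻¹)))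
      (by fun_prop) hX (hX0.mono fun _ h => h.le) (fun r hr => ?_) ht).1.congr
      (zpow_mul_exp_ae_eq_right hX0 _ s t)
    refine (ih s r hs hr).congr (Eventually.of_forall fun ω => ?_)
    simp only
    rw [neg_add, exp_add, mul_assoc]
  | pred k ih =>
    intro s t hs ht
    refine (hasDerivAt_integral_mul_exp_neg (W := fun ω => X ω ^ (-k : ℤ) * exp (-(t * X ω)))
      (T := fun ω => (X ω)⁻¹)
      (by fun_prop) hX.inv (hX0.mono fun _ h => (inv_pos.2 h).le) (fun r hr => ?_) hs).1.congr
      (zpow_mul_exp_ae_eq_left hX0 _ s t)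
    refine (ih r t hr ht).congr (Eventually.of_forall fun ω => ?_)
    simp only
    rw [neg_add, exp_add]
    ring

lemma hasDerivAt_gigMoment_right (hX : Measurable X) (hX0 : ∀ᵐ ω ∂P, 0 < X ω) (k : ℤ)
    {s t : ℝ} (hs : 0 < s) (ht : 0 < t) :
    HasDerivAt (fun r => gigMoment P X k s r) (-gigMoment P X (k + 1) s t) t := by
  have h := (hasDerivAt_integral_mul_exp_neg (P := P)
    (W := fun ω => X ω ^ k * exp (-(s * (X ω)⁻¹)))
    (by fun_prop) hX (hX0.mono fun _ h => h.le) (fun r hr => ?_) ht).2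
  · rw [integral_congr_ae (zpow_mul_exp_ae_eq_right hX0 k s t)] at h
    refine h.congr_of_eventuallyEq (Eventually.of_forall fun r => ?_)
    refine integral_congr_ae (Eventually.of_forall fun ω => ?_)
    simp only
    rw [neg_add, exp_add, mul_assoc]
  · refine (integrable_zpow_mul_exp hX hX0 k s r hs hr).congr (Eventually.of_forall fun ω => ?_)
    simp only
    rw [neg_add, exp_add, mul_assoc]

lemma hasDerivAt_gigMoment_left (hX : Measurable X) (hX0 : ∀ᵐ ω ∂P, 0 < X ω) (k : ℤ)
    {s t : ℝ} (hs : 0 < s) (ht : 0 < t) :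
    HasDerivAt (fun r => gigMoment P X k r t) (-gigMoment P X (k - 1) s t) s := by
  have h := (hasDerivAt_integral_mul_exp_neg (P := P)
    (W := fun ω => X ω ^ k * exp (-(t * X ω))) (T := fun ω => (X ω)⁻¹)
    (by fun_prop) hX.inv (hX0.mono fun _ h => (inv_pos.2 h).le) (fun r hr => ?_) hs).2
  · rw [integral_congr_ae (zpow_mul_exp_ae_eq_left hX0 k s t)] at h
    refine h.congr_of_eventuallyEq (Eventually.of_forall fun r => ?_)
    refine integral_congr_ae (Eventually.of_forall fun ω => ?_)
    simp only
    rw [neg_add, exp_add]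
    ring
  · refine (integrable_zpow_mul_exp hX hX0 k r t hr ht).congr (Eventually.of_forall fun ω => ?_)
    simp only
    rw [neg_add, exp_add]
    ring

lemma gigMoment_pos [NeZero P] (hX : Measurable X) (hX0 : ∀ᵐ ω ∂P, 0 < X ω) (k : ℤ)
    {s t : ℝ} (hs : 0 < s) (ht : 0 < t) : 0 < gigMoment P X k s t := by
  refine integral_pos_of_ae_pos ?_ (integrable_zpow_mul_exp hX hX0 k s t hs ht)
  filter_upwards [hX0] with ω h
  positivity

end gigMoment

/-- A finite measure on the positive half-line is determined by the values of its Laplace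
transform at the natural numbers. -/
lemma ext_of_integral_exp_neg_nat {ν₁ ν₂ : Measure ℝ} [IsFiniteMeasure ν₁] [IsFiniteMeasure ν₂]
    (h₁ : ∀ᵐ x ∂ν₁, 0 < x) (h₂ : ∀ᵐ x ∂ν₂, 0 < x)
    (h : ∀ n : ℕ, ∫ x, exp (-(n * x)) ∂ν₁ = ∫ x, exp (-(n * x)) ∂ν₂) : ν₁ = ν₂ := by
  let f : BoundedContinuousFunction NNReal ℝ :=
    BoundedContinuousFunction.ofNormedAddCommGroup (fun x : NNReal => exp (-(x : ℝ)))
      (by fun_prop) 1 (fun x => by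
        rw [Real.norm_eq_abs, abs_of_pos (exp_pos _), exp_le_one_iff]; simp)
  have hf (x : NNReal) : f x = exp (-(x : ℝ)) := rfl
  let A : StarSubalgebra ℝ (BoundedContinuousFunction NNReal ℝ) :=
    { (Polynomial.aeval (R := ℝ) f).range with
      star_mem' := by
        intro g hg
        have : star g = g := by ext x; simp
        rwa [this] }
  have hmap : ν₁.map Real.toNNReal = ν₂.map Real.toNNReal := by
    have m₁ : IsFiniteMeasure (ν₁.map Real.toNNReal) := Measure.isFiniteMeasure_map _ _
    have m₂ : IsFiniteMeasure (ν₂.map Real.toNNReal) := Measure.isFiniteMeasure_map _ _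
    refine ext_of_forall_mem_subalgebra_integral_eq_of_polish (𝕜 := ℝ) (A := A) ?_ ?_
    · intro x y hxy
      refine ⟨f, ⟨f.toContinuousMap, ⟨f, ⟨Polynomial.X, by simp⟩, rfl⟩, rfl⟩, ?_⟩
      rw [hf, hf]
      intro he
      exact hxy (NNReal.coe_injective (neg_injective (exp_injective he)))
    · rintro _ ⟨q, rfl⟩
      have key (ν : Measure ℝ) [IsFiniteMeasure ν] (hν : ∀ᵐ x ∂ν, 0 < x) :
          ∫ x, (Polynomial.aeval f q) x ∂(ν.map Real.toNNReal) =
            ∑ n ∈ Finset.range (q.natDegree + 1), q.coeff n * ∫ x, exp (-(n * x)) ∂ν := by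
        rw [integral_map (by fun_prop) (by fun_prop)]
        have e : ∀ᵐ x ∂ν, (Polynomial.aeval f q) x.toNNReal =
            ∑ n ∈ Finset.range (q.natDegree + 1), q.coeff n * exp (-(n * x)) := by
          filter_upwards [hν] with x hx
          rw [Polynomial.aeval_eq_sum_range, BoundedContinuousFunction.sum_apply]
          refine Finset.sum_congr rfl fun n _ => ?_
          rw [BoundedContinuousFunction.smul_apply, smul_eq_mul, BoundedContinuousFunction.pow_apply,
            hf, ← exp_nat_mul, Real.coe_toNNReal x hx.le, mul_neg]
        rw [integral_congr_ae e, integral_finsetSum]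
        · simp_rw [integral_const_mul]
        · intro n _
          refine Integrable.const_mul (Integrable.of_bound (by fun_prop) 1 ?_) _
          filter_upwards [hν] with x hx
          rw [Real.norm_eq_abs, abs_of_pos (exp_pos _), exp_le_one_iff]
          have : 0 ≤ (n : ℝ) * x := by positivity
          linarith
      have := key ν₁ h₁
      simp_rw [h] at this
      exact this.trans (key ν₂ h₂).symm
  have back (ν : Measure ℝ) (hν : ∀ᵐ x ∂ν, 0 < x) :
      (ν.map Real.toNNReal).map ((↑) : NNReal → ℝ) = ν := by
    rw [Measure.map_map (by fun_prop) (by fun_prop)]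
    conv_rhs => rw [← Measure.map_id (μ := ν)]
    refine Measure.map_congr ?_
    filter_upwards [hν] with x hx
    simp [hx.le]
  rw [← back ν₁ h₁, ← back ν₂ h₂, hmap]

/-- A finite measure on the positive half-line is determined by a weighted Laplace transform. -/
lemma ext_of_integral_mul_exp_neg {ν₁ ν₂ : Measure ℝ} [IsFiniteMeasure ν₁] [IsFiniteMeasure ν₂]
    (h₁ : ∀ᵐ x ∂ν₁, 0 < x) (h₂ : ∀ᵐ x ∂ν₂, 0 < x) {w : ℝ → ℝ} (hw : Measurable w)
    (hw0 : ∀ x > 0, 0 < w x)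
    (i₁ : Integrable (fun x => w x * exp (-x)) ν₁) (i₂ : Integrable (fun x => w x * exp (-x)) ν₂)
    (h : ∀ t > 0, ∫ x, w x * exp (-(t * x)) ∂ν₁ = ∫ x, w x * exp (-(t * x)) ∂ν₂) : ν₁ = ν₂ := by
  let f : ℝ → ENNReal := fun x => ENNReal.ofReal (w x * exp (-x))
  have hf : Measurable f := by fun_prop
  have hpos (ν : Measure ℝ) (hν : ∀ᵐ x ∂ν, 0 < x) : ∀ᵐ x ∂ν, f x ≠ 0 := by
    filter_upwards [hν] with x hx
    have := hw0 x hx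
    simp only [f, ne_eq, ENNReal.ofReal_eq_zero, not_le]
    positivity
  have fin₁ : IsFiniteMeasure (ν₁.withDensity f) :=
    isFiniteMeasure_withDensity_ofReal i₁.2
  have fin₂ : IsFiniteMeasure (ν₂.withDensity f) :=
    isFiniteMeasure_withDensity_ofReal i₂.2
  have key (ν : Measure ℝ) (hν : ∀ᵐ x ∂ν, 0 < x) (n : ℕ) :
      ∫ x, exp (-(n * x)) ∂(ν.withDensity f) = ∫ x, w x * exp (-((n + 1 : ℝ) * x)) ∂ν := by
    rw [integral_withDensity_eq_integral_toReal_smul hf (by simp [f])]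
    refine integral_congr_ae ?_
    filter_upwards [hν] with x hx
    have := hw0 x hx
    rw [ENNReal.toReal_ofReal (by positivity), smul_eq_mul, mul_assoc, ← exp_add]
    ring_nf
  have hρ : ν₁.withDensity f = ν₂.withDensity f := by
    refine ext_of_integral_exp_neg_nat ?_ ?_ fun n => ?_
    · exact (withDensity_absolutelyContinuous _ _).ae_le h₁
    · exact (withDensity_absolutelyContinuous _ _).ae_le h₂
    · rw [key ν₁ h₁, key ν₂ h₂, h _ (by positivity)]
  rw [← withDensity_inv_same hf (hpos ν₁ h₁) (by simp [f]),
    ← withDensity_inv_same hf (hpos ν₂ h₂) (by simp [f]), hρ]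

lemma eq_of_hasDerivAt_zero_Ioi {f : ℝ → ℝ} (hf : ∀ t > 0, HasDerivAt f 0 t) {x y : ℝ}
    (hx : 0 < x) (hy : 0 < y) : f x = f y :=
  isOpen_Ioi.is_const_of_deriv_eq_zero (isPreconnected_Ioi (a := (0 : ℝ)))
    (fun t ht => (hf t ht).differentiableAt.differentiableWithinAt)
    (fun t ht => (hf t ht).deriv) hx hy

/-- The moments `E[T ^ k * exp (-(t * T))]`. -/
noncomputable def laplaceMoment {α : Type*} [MeasurableSpace α] (P : Measure α) (T : α → ℝ)
    (k : ℕ) (t : ℝ) : ℝ :=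
  ∫ ω, T ω ^ k * exp (-(t * T ω)) ∂P

section laplaceMoment

variable {α : Type*} [MeasurableSpace α] {P : Measure α} {T : α → ℝ}

lemma integrable_pow_mul_exp [IsFiniteMeasure P] (hT : Measurable T) (hT0 : ∀ᵐ ω ∂P, 0 < T ω)
    (k : ℕ) : ∀ t > 0, Integrable (fun ω => T ω ^ k * exp (-(t * T ω))) P := by
  induction k with
  | zero =>
    intro t ht
    refine Integrable.of_bound (by fun_prop) 1 ?_
    filter_upwards [hT0] with ω h
    rw [pow_zero, one_mul, Real.norm_eq_abs, abs_of_pos (exp_pos _), exp_le_one_iff]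
    nlinarith
  | succ k ih =>
    intro t ht
    simpa only [pow_succ] using (hasDerivAt_integral_mul_exp_neg (W := fun ω => T ω ^ k)
      (by fun_prop) hT (hT0.mono fun _ h => h.le) ih ht).1

lemma hasDerivAt_laplaceMoment [IsFiniteMeasure P] (hT : Measurable T)
    (hT0 : ∀ᵐ ω ∂P, 0 < T ω) (k : ℕ) {t : ℝ} (ht : 0 < t) :
    HasDerivAt (laplaceMoment P T k) (-laplaceMoment P T (k + 1) t) t := by
  have h := (hasDerivAt_integral_mul_exp_neg (W := fun ω => T ω ^ k)
    (by fun_prop) hT (hT0.mono fun _ h => h.le) (integrable_pow_mul_exp hT hT0 k) ht).2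
  simp only [← pow_succ] at h
  exact h

lemma laplaceMoment_pos [IsFiniteMeasure P] [NeZero P] (hT : Measurable T)
    (hT0 : ∀ᵐ ω ∂P, 0 < T ω) (k : ℕ) {t : ℝ} (ht : 0 < t) : 0 < laplaceMoment P T k t := by
  refine integral_pos_of_ae_pos ?_ (integrable_pow_mul_exp hT hT0 k t ht)
  filter_upwards [hT0] with ω h
  positivity

/-- Strict Cauchy–Schwarz inequality for the tilted moments of a nonconstant variable. -/
lemma laplaceMoment_one_sq_lt [IsFiniteMeasure P] [NeZero P] (hT : Measurable T)
    (hT0 : ∀ᵐ ω ∂P, 0 < T ω) (hnd : ¬ ∃ c : ℝ, ∀ᵐ ω ∂P, T ω = c) {t : ℝ} (ht : 0 < t) :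
    laplaceMoment P T 1 t ^ 2 < laplaceMoment P T 0 t * laplaceMoment P T 2 t := by
  have p0 := laplaceMoment_pos hT hT0 0 ht
  set m := laplaceMoment P T 1 t / laplaceMoment P T 0 t with hm
  have i (k : ℕ) := integrable_pow_mul_exp hT hT0 k t ht
  have hint : Integrable (fun ω => (T ω - m) ^ 2 * exp (-(t * T ω))) P := by
    refine (((i 2).sub ((i 1).const_mul (2 * m))).add ((i 0).const_mul (m ^ 2))).congr
      (Eventually.of_forall fun ω => ?_)
    simp only [Pi.add_apply, Pi.sub_apply]
    ring
  have heq : ∫ ω, (T ω - m) ^ 2 * exp (-(t * T ω)) ∂P =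
      laplaceMoment P T 2 t - 2 * m * laplaceMoment P T 1 t + m ^ 2 * laplaceMoment P T 0 t := by
    have j : Integrable (fun ω => T ω ^ 2 * exp (-(t * T ω)) -
        2 * m * (T ω ^ 1 * exp (-(t * T ω)))) P := (i 2).sub ((i 1).const_mul _)
    simp only [laplaceMoment]
    rw [← integral_const_mul, ← integral_const_mul, ← integral_sub (i 2) ((i 1).const_mul _),
      ← integral_add j ((i 0).const_mul _)]
    refine integral_congr_ae (Eventually.of_forall fun ω => ?_)
    simp only
    ring
  have h0 : 0 ≤ᵐ[P] fun ω => (T ω - m) ^ 2 * exp (-(t * T ω)) :=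
    Eventually.of_forall fun ω => by simp only [Pi.zero_apply]; positivity
  have hpos : 0 < ∫ ω, (T ω - m) ^ 2 * exp (-(t * T ω)) ∂P := by
    refine (integral_nonneg_of_ae h0).lt_of_ne fun h => hnd ⟨m, ?_⟩
    filter_upwards [(integral_eq_zero_iff_of_nonneg_ae h0 hint).1 h.symm] with ω hω
    have : (T ω - m) ^ 2 = 0 := (mul_eq_zero.1 hω).resolve_right (exp_pos _).ne'
    exact sub_eq_zero.1 (pow_eq_zero_iff two_ne_zero |>.1 this)
  rw [heq] at hpos
  have h1 : m * laplaceMoment P T 0 t = laplaceMoment P T 1 t := by rw [hm]; field_simp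
  nlinarith [mul_pos hpos p0]

lemma tendsto_laplaceMoment_zero [IsProbabilityMeasure P] (hT : Measurable T)
    (hT0 : ∀ᵐ ω ∂P, 0 < T ω) :
    Tendsto (laplaceMoment P T 0) (nhdsWithin 0 (Ioi 0)) (nhds 1) := by
  have : Tendsto (laplaceMoment P T 0) (nhdsWithin 0 (Ioi 0)) (nhds (∫ _, (1 : ℝ) ∂P)) := by
    refine tendsto_integral_filter_of_dominated_convergence (fun _ => 1)
      (Eventually.of_forall fun t => by fun_prop) ?_ (integrable_const _) ?_
    · filter_upwards [self_mem_nhdsWithin] with t ht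
      filter_upwards [hT0] with ω h
      rw [pow_zero, one_mul, Real.norm_eq_abs, abs_of_pos (exp_pos _), exp_le_one_iff]
      have : 0 < t * T ω := mul_pos ht h
      linarith
    · refine Eventually.of_forall fun ω => ?_
      have : Continuous fun t : ℝ => T ω ^ 0 * exp (-(t * T ω)) := by fun_prop
      simpa using (this.tendsto 0).mono_left nhdsWithin_le_nhds
  simpa using this

/-- The ratio of the first two tilted moments determines the Laplace transform. -/
lemma laplaceMoment_zero_eq [IsProbabilityMeasure P] (hT : Measurable T)
    (hT0 : ∀ᵐ ω ∂P, 0 < T ω) {c e : ℝ} (hc : 0 < c) (he : 0 ≤ e)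
    (h : ∀ t > 0, laplaceMoment P T 0 t = (c * t + e) * laplaceMoment P T 1 t) :
    0 < e ∧ ∀ t > 0, laplaceMoment P T 0 t = (e / (c * t + e)) ^ (1 / c) := by
  set φ : ℝ → ℝ := fun t => laplaceMoment P T 0 t * (c * t + e) ^ (1 / c) with hφ
  have hlin (t : ℝ) (ht : 0 < t) : 0 < c * t + e := by positivity
  have hd : ∀ t > 0, HasDerivAt φ 0 t := by
    intro t ht
    have h1 := (((hasDerivAt_id t).const_mul c).add_const e).rpow_const (p := 1 / c)
      (Or.inl (hlin t ht).ne')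
    have h2 := (hasDerivAt_laplaceMoment hT hT0 0 ht).mul h1
    convert! h2 using 1
    simp only [id, mul_one, zero_add]
    rw [rpow_sub_one (hlin t ht).ne', h t ht]
    have := (hlin t ht).ne'
    field_simp
    ring
  have hlim : Tendsto φ (nhdsWithin 0 (Ioi 0)) (nhds (1 * e ^ (1 / c))) := by
    refine (tendsto_laplaceMoment_zero hT hT0).mul ?_
    have hcont : Continuous fun t : ℝ => (c * t + e) ^ (1 / c) :=
      (by fun_prop : Continuous fun t : ℝ => c * t + e).rpow_const
        fun _ => Or.inr (by positivity)
    simpa using (hcont.tendsto 0).mono_left nhdsWithin_le_nhds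
  have hval : ∀ t > 0, φ t = e ^ (1 / c) := by
    intro t ht
    rw [one_mul] at hlim
    refine tendsto_nhds_unique (tendsto_const_nhds.congr' ?_) hlim
    filter_upwards [self_mem_nhdsWithin] with r hr
    exact eq_of_hasDerivAt_zero_Ioi hd ht hr
  have he' : 0 < e := by
    refine he.lt_of_ne fun h0 => ?_
    have h1 := hval 1 one_pos
    rw [← h0, zero_rpow (by positivity)] at h1
    have h2 := laplaceMoment_pos hT hT0 0 one_pos
    have h3 := rpow_pos_of_pos (hlin 1 one_pos) (1 / c)
    rw [← h0] at h3
    have : φ 1 = laplaceMoment P T 0 1 * (c * 1 + 0) ^ (1 / c) := by simp only [hφ, ← h0]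
    exact (mul_pos h2 h3).ne' (this ▸ h1)
  refine ⟨he', fun t ht => ?_⟩
  rw [div_rpow he (hlin t ht).le, ← hval t ht, hφ]
  have := (rpow_pos_of_pos (hlin t ht) (1 / c)).ne'
  field_simp

end laplaceMoment

/-- Integration against a measure with a real density carried by the positive half-line. -/
lemma integral_withDensity_ofReal_Ioi {g : ℝ → ℝ} (hg : Measurable g) (hg0 : ∀ x, 0 ≤ g x)
    (hgs : ∀ x ≤ 0, g x = 0) (f : ℝ → ℝ) :
    ∫ x, f x ∂(volume.withDensity fun x => ENNReal.ofReal (g x)) = ∫ x in Ioi 0, g x * f x := by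
  rw [integral_withDensity_eq_integral_toReal_smul (by fun_prop) (by simp)]
  simp_rw [ENNReal.toReal_ofReal (hg0 _), smul_eq_mul]
  refine (setIntegral_eq_integral_of_forall_compl_eq_zero fun x hx => ?_).symm
  rw [hgs x (not_lt.1 hx), zero_mul]

lemma ae_pos_withDensity_ofReal {g : ℝ → ℝ} (hg : Measurable g) (hgs : ∀ x ≤ 0, g x = 0) :
    ∀ᵐ x ∂(volume.withDensity fun x => ENNReal.ofReal (g x)), 0 < x := by
  rw [ae_withDensity_iff (by fun_prop)]
  refine Eventually.of_forall fun x hx => ?_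
  by_contra h
  exact hx (by rw [hgs x (not_lt.1 h), ENNReal.ofReal_zero])

lemma gampdf_nonneg (p c x : ℝ) : 0 ≤ gampdf p c x := by
  unfold gampdf
  split_ifs with h <;> positivity

lemma gampdf_of_nonpos (p c : ℝ) {x : ℝ} (hx : x ≤ 0) : gampdf p c x = 0 :=
  if_neg hx.not_gt

lemma gigpdf_of_nonpos (p a b : ℝ) {x : ℝ} (hx : x ≤ 0) : gigpdf p a b x = 0 :=
  if_neg hx.not_gt

/-- Identification of a Gamma law through its Laplace transform. -/
lemma hasLawGamma_of_laplaceMoment {α : Type*} [MeasurableSpace α] {P : Measure α}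
    [IsProbabilityMeasure P] {T : α → ℝ} (hT : Measurable T) (hT0 : ∀ᵐ ω ∂P, 0 < T ω)
    {p r : ℝ} (hp : 0 < p) (hr : 0 < r)
    (h : ∀ t > 0, laplaceMoment P T 0 t = (r / (t + r)) ^ p) : HasLawGamma P T p r := by
  have hG := Gamma_pos_of_pos hp
  set k := r ^ p / Gamma p with hk
  have hk0 : 0 < k := by positivity
  refine ⟨k, hk0, ?_⟩
  have hmeas : Measurable fun x => k * gampdf p r x := (measurable_gampdf p r).const_mul k
  have hnn (x : ℝ) : 0 ≤ k * gampdf p r x := mul_nonneg hk0.le (gampdf_nonneg p r x)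
  have hs (x : ℝ) (hx : x ≤ 0) : k * gampdf p r x = 0 := by rw [gampdf_of_nonpos _ _ hx, mul_zero]
  have hI (t : ℝ) (ht : 0 < t + r) :
      ∫ x, exp (-(t * x)) ∂(volume.withDensity fun x => ENNReal.ofReal (k * gampdf p r x)) =
        (r / (t + r)) ^ p := by
    rw [integral_withDensity_ofReal_Ioi hmeas hnn hs]
    have : ∫ x in Ioi 0, k * gampdf p r x * exp (-(t * x)) =
        ∫ x in Ioi 0, k * (x ^ (p - 1) * exp (-((t + r) * x))) := by
      refine setIntegral_congr_fun measurableSet_Ioi fun x hx => ?_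
      simp only [gampdf, if_pos (mem_Ioi.1 hx)]
      rw [mul_assoc, mul_assoc, ← exp_add]
      ring_nf
    rw [this, integral_const_mul, integral_rpow_mul_exp_neg_mul_Ioi hp ht, hk,
      div_rpow hr.le ht.le, div_rpow zero_le_one ht.le, one_rpow]
    field_simp
  have hfin : IsFiniteMeasure (volume.withDensity fun x => ENNReal.ofReal (k * gampdf p r x)) := by
    have h0 := hI 0 (by linarith)
    have hi : Integrable (fun _ : ℝ => exp (-(0 * (0 : ℝ))))
        (volume.withDensity fun x => ENNReal.ofReal (k * gampdf p r x)) := by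
      refine Integrable.congr (f := fun x : ℝ => exp (-(0 * x))) ?_
        (Eventually.of_forall fun x => by simp)
      refine not_imp_comm.1 integral_undef ?_
      rw [h0]; positivity
    refine (integrable_const_iff_isFiniteMeasure (exp_pos _).ne').1 hi
  have hTp : ∀ᵐ x ∂(P.map T), 0 < x := (ae_map_iff hT.aemeasurable measurableSet_Ioi).2 hT0
  have : IsProbabilityMeasure (P.map T) := Measure.isProbabilityMeasure_map hT.aemeasurable
  have hb (ν : Measure ℝ) [IsFiniteMeasure ν] (hν : ∀ᵐ x ∂ν, 0 < x) :
      Integrable (fun x => (1 : ℝ) * exp (-x)) ν := by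
    simpa using integrable_pow_mul_exp measurable_id hν 0 1 one_pos
  have hq := ae_pos_withDensity_ofReal hmeas hs
  refine ext_of_integral_mul_exp_neg hTp hq measurable_const (fun _ _ => one_pos)
    (hb _ hTp) (hb _ hq) fun t ht => ?_
  simp_rw [one_mul]
  rw [hI t (by linarith), integral_map hT.aemeasurable (by fun_prop), ← h t ht]
  simp [laplaceMoment]

section Characterization

variable {α : Type*} [MeasurableSpace α] {P : Measure α}

/-- If the ratio of the joint transforms of `X` and `U` factorizes, the tilted means of `Y` and `V`
are affine with a common slope, and the moments of `X` satisfy a linear relation. -/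
lemma exists_affine_of_factorization [IsFiniteMeasure P] [NeZero P] {X Y U V : α → ℝ}
    (hX : Measurable X) (hY : Measurable Y) (hU : Measurable U) (hV : Measurable V)
    (hX0 : ∀ᵐ ω ∂P, 0 < X ω) (hY0 : ∀ᵐ ω ∂P, 0 < Y ω)
    (hU0 : ∀ᵐ ω ∂P, 0 < U ω) (hV0 : ∀ᵐ ω ∂P, 0 < V ω)
    (hYnd : ¬ ∃ c : ℝ, ∀ᵐ ω ∂P, Y ω = c)
    (h : ∀ s t : ℝ, 0 < s → 0 < t → gigMoment P X 0 s t * laplaceMoment P Y 0 t =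
      gigMoment P U 0 t s * laplaceMoment P V 0 s) :
    ∃ c d e : ℝ, 0 < c ∧ 0 ≤ d ∧ 0 ≤ e ∧
      (∀ s > 0, laplaceMoment P V 0 s = (c * s + d) * laplaceMoment P V 1 s) ∧
      (∀ t > 0, laplaceMoment P Y 0 t = (c * t + e) * laplaceMoment P Y 1 t) ∧
      ∀ s t : ℝ, 0 < s → 0 < t → (c * s + d) * gigMoment P X (-1) s t =
        (c * t + e) * gigMoment P X 1 s t + gigMoment P X 0 s t := by
  have E1 (s t : ℝ) (hs : 0 < s) (ht : 0 < t) :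
      gigMoment P X 1 s t * laplaceMoment P Y 0 t + gigMoment P X 0 s t * laplaceMoment P Y 1 t =
        gigMoment P U (-1) t s * laplaceMoment P V 0 s := by
    have d1 := (hasDerivAt_gigMoment_right hX hX0 0 hs ht).mul
      (hasDerivAt_laplaceMoment hY hY0 0 ht)
    have d2 := (hasDerivAt_gigMoment_left hU hU0 0 ht hs).mul_const (laplaceMoment P V 0 s)
    have := d1.unique (d2.congr_of_eventuallyEq ((eventually_gt_nhds ht).mono fun r hr =>
      h s r hs hr))
    simp only [zero_add, zero_sub] at this
    linarith
  have E2 (s t : ℝ) (hs : 0 < s) (ht : 0 < t) :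
      gigMoment P X (-1) s t * laplaceMoment P Y 1 t =
        gigMoment P U (-1) t s * laplaceMoment P V 1 s := by
    have d1 := ((hasDerivAt_gigMoment_left hX hX0 1 hs ht).mul_const (laplaceMoment P Y 0 t)).add
      ((hasDerivAt_gigMoment_left hX hX0 0 hs ht).mul_const (laplaceMoment P Y 1 t))
    have d2 := (hasDerivAt_gigMoment_right hU hU0 (-1) ht hs).mul
      (hasDerivAt_laplaceMoment hV hV0 0 hs)
    have := d1.unique (d2.congr_of_eventuallyEq ((eventually_gt_nhds hs).mono fun r hr =>
      E1 r t hr ht))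
    simp only [zero_add, zero_sub, sub_self, neg_add_cancel] at this
    linarith [h s t hs ht]
  set A : ℝ → ℝ := fun s => laplaceMoment P V 0 s / laplaceMoment P V 1 s with hA
  set B : ℝ → ℝ := fun t => laplaceMoment P Y 0 t / laplaceMoment P Y 1 t with hB
  have pV (k : ℕ) {s : ℝ} (hs : 0 < s) := laplaceMoment_pos hV hV0 k hs
  have pY (k : ℕ) {t : ℝ} (ht : 0 < t) := laplaceMoment_pos hY hY0 k ht
  have hA0 (s : ℝ) (hs : 0 < s) : 0 < A s := div_pos (pV 0 hs) (pV 1 hs)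
  have hB0 (t : ℝ) (ht : 0 < t) : 0 < B t := div_pos (pY 0 ht) (pY 1 ht)
  have hAV (s : ℝ) (hs : 0 < s) : laplaceMoment P V 0 s = A s * laplaceMoment P V 1 s :=
    (div_mul_cancel₀ _ (pV 1 hs).ne').symm
  have hBY (t : ℝ) (ht : 0 < t) : laplaceMoment P Y 0 t = B t * laplaceMoment P Y 1 t :=
    (div_mul_cancel₀ _ (pY 1 ht).ne').symm
  have E3 (s t : ℝ) (hs : 0 < s) (ht : 0 < t) :
      A s * gigMoment P X (-1) s t = B t * gigMoment P X 1 s t + gigMoment P X 0 s t := by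
    have e1 := E1 s t hs ht
    have e2 := E2 s t hs ht
    rw [hBY t ht, hAV s hs] at e1
    have hy := pY 1 ht
    have : laplaceMoment P Y 1 t * (A s * gigMoment P X (-1) s t) =
        laplaceMoment P Y 1 t * (B t * gigMoment P X 1 s t + gigMoment P X 0 s t) := by
      linear_combination A s * e2 - e1
    exact mul_left_cancel₀ hy.ne' this
  have ratio_deriv {T : α → ℝ} (hT : Measurable T) (hT0 : ∀ᵐ ω ∂P, 0 < T ω) {t : ℝ}
      (ht : 0 < t) : HasDerivAt (fun t => laplaceMoment P T 0 t / laplaceMoment P T 1 t)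
        ((laplaceMoment P T 0 t * laplaceMoment P T 2 t - laplaceMoment P T 1 t ^ 2) /
          laplaceMoment P T 1 t ^ 2) t := by
    refine ((hasDerivAt_laplaceMoment hT hT0 0 ht).div (hasDerivAt_laplaceMoment hT hT0 1 ht)
      (laplaceMoment_pos hT hT0 1 ht).ne').congr_deriv ?_
    simp only [zero_add, Nat.reduceAdd]
    ring
  set A' : ℝ → ℝ := fun t =>
    (laplaceMoment P V 0 t * laplaceMoment P V 2 t - laplaceMoment P V 1 t ^ 2) /
          laplaceMoment P V 1 t ^ 2
  set B' : ℝ → ℝ := fun t =>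
    (laplaceMoment P Y 0 t * laplaceMoment P Y 2 t - laplaceMoment P Y 1 t ^ 2) /
          laplaceMoment P Y 1 t ^ 2
  have dA (s : ℝ) (hs : 0 < s) : HasDerivAt A (A' s) s := ratio_deriv hV hV0 hs
  have dB (t : ℝ) (ht : 0 < t) : HasDerivAt B (B' t) t := ratio_deriv hY hY0 ht
  have E4 (s t : ℝ) (hs : 0 < s) (ht : 0 < t) :
      -(A s * gigMoment P X 0 s t) = B' t * gigMoment P X 1 s t - B t * gigMoment P X 2 s t -
        gigMoment P X 1 s t := by
    have d1 := (hasDerivAt_gigMoment_right hX hX0 (-1) hs ht).const_mul (A s)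
    have d2 := ((dB t ht).mul (hasDerivAt_gigMoment_right hX hX0 1 hs ht)).add
      (hasDerivAt_gigMoment_right hX hX0 0 hs ht)
    have := d1.unique (d2.congr_of_eventuallyEq ((eventually_gt_nhds ht).mono fun r hr =>
      E3 s r hs hr))
    simp only [zero_add, neg_add_cancel, Int.reduceAdd] at this
    linarith
  have E5 (s t : ℝ) (hs : 0 < s) (ht : 0 < t) : A' s = B' t := by
    have d1 := ((dA s hs).mul (hasDerivAt_gigMoment_left hX hX0 0 hs ht)).neg
    have d2 := (((hasDerivAt_gigMoment_left hX hX0 1 hs ht).const_mul (B' t)).sub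
      ((hasDerivAt_gigMoment_left hX hX0 2 hs ht).const_mul (B t))).sub
      (hasDerivAt_gigMoment_left hX hX0 1 hs ht)
    have := d1.unique (d2.congr_of_eventuallyEq ((eventually_gt_nhds hs).mono fun r hr =>
      E4 r t hr ht))
    simp only [zero_sub, sub_self, Int.reduceSub] at this
    have e3 := E3 s t hs ht
    refine mul_right_cancel₀ (gigMoment_pos hX hX0 0 hs ht).ne' ?_
    linarith
  set c := B' 1 with hc
  have hc0 : 0 < c :=
    div_pos (sub_pos.2 (laplaceMoment_one_sq_lt hY hY0 hYnd one_pos)) (pow_pos (pY 1 one_pos) 2)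
  have affine {f f' : ℝ → ℝ} (hf : ∀ t > 0, HasDerivAt f (f' t) t) (hf' : ∀ t > 0, f' t = c)
      (hf0 : ∀ t > 0, 0 < f t) : ∃ e, 0 ≤ e ∧ ∀ t > 0, f t = c * t + e := by
    have hd : ∀ t > 0, HasDerivAt (fun t => f t - c * t) 0 t := fun t ht => by
      refine ((hf t ht).sub ((hasDerivAt_id t).const_mul c)).congr_deriv ?_
      rw [hf' t ht]; ring
    have he (t : ℝ) (ht : 0 < t) : f t = c * t + (f 1 - c * 1) := by
      have := eq_of_hasDerivAt_zero_Ioi hd ht one_pos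
      linarith
    refine ⟨f 1 - c * 1, ?_, he⟩
    by_contra! hneg
    set e := f 1 - c * 1
    have ht : 0 < -e / c := div_pos (by linarith) hc0
    have h1 := hf0 _ ht
    rw [he _ ht, mul_div_cancel₀ _ hc0.ne'] at h1
    linarith
  obtain ⟨d, hd, hAd⟩ := affine dA (fun s hs => E5 s 1 hs one_pos) hA0
  obtain ⟨e, he, hBe⟩ := affine dB
    (fun t ht => (E5 1 t one_pos ht).symm.trans (E5 1 1 one_pos one_pos)) hB0
  refine ⟨c, d, e, hc0, hd, he, fun s hs => ?_, fun t ht => ?_, fun s t hs ht => ?_⟩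
  · rw [← hAd s hs, hAV s hs]
  · rw [← hBe t ht, hBY t ht]
  · rw [← hAd s hs, ← hBe t ht, E3 s t hs ht]

end Characterization

lemma gigMoment_antitone {α : Type*} [MeasurableSpace α] {P : Measure α} [IsFiniteMeasure P]
    {X : α → ℝ} (hX : Measurable X) (hX0 : ∀ᵐ ω ∂P, 0 < X ω) (k : ℤ) {s t u : ℝ} (hs : 0 < s)
    (ht : 0 < t) (htu : t ≤ u) : gigMoment P X k s u ≤ gigMoment P X k s t := by
  refine integral_mono_ae (integrable_zpow_mul_exp hX hX0 k s u hs (ht.trans_le htu))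
    (integrable_zpow_mul_exp hX hX0 k s t hs ht) ?_
  filter_upwards [hX0] with ω h
  gcongr

/-- Up to a multiplicative constant, the linear moment relation has at most one solution. -/
lemma exists_eq_smul_of_moment_relation {ν ν' : Measure ℝ} [IsFiniteMeasure ν] [NeZero ν]
    [IsFiniteMeasure ν'] [NeZero ν'] (hν : ∀ᵐ x ∂ν, 0 < x) (hν' : ∀ᵐ x ∂ν', 0 < x)
    {c d e : ℝ} (hc : 0 < c) (he : 0 < e)
    (h : ∀ s t : ℝ, 0 < s → 0 < t → (c * s + d) * gigMoment ν id (-1) s t =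
      (c * t + e) * gigMoment ν id 1 s t + gigMoment ν id 0 s t)
    (h' : ∀ s t : ℝ, 0 < s → 0 < t → (c * s + d) * gigMoment ν' id (-1) s t =
      (c * t + e) * gigMoment ν' id 1 s t + gigMoment ν' id 0 s t) :
    ∃ C : ℝ, 0 < C ∧ ν = ENNReal.ofReal C • ν' := by
  set m : ℝ → ℝ := fun t => gigMoment ν id (-1) 1 t with hm
  set m₀ : ℝ → ℝ := fun t => gigMoment ν id 0 1 t with hm₀
  set m₁ : ℝ → ℝ := fun t => gigMoment ν id 1 1 t with hm₁
  set n : ℝ → ℝ := fun t => gigMoment ν' id (-1) 1 t with hn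
  set n₀ : ℝ → ℝ := fun t => gigMoment ν' id 0 1 t with hn₀
  set n₁ : ℝ → ℝ := fun t => gigMoment ν' id 1 1 t with hn₁
  have pos (k : ℤ) {t : ℝ} (ht : 0 < t) : 0 < gigMoment ν id k 1 t :=
    gigMoment_pos measurable_id hν k one_pos ht
  have pos' (k : ℤ) {t : ℝ} (ht : 0 < t) : 0 < gigMoment ν' id k 1 t :=
    gigMoment_pos measurable_id hν' k one_pos ht
  have dm (t : ℝ) (ht : 0 < t) : HasDerivAt m (-m₀ t) t :=
    hasDerivAt_gigMoment_right measurable_id hν (-1) one_pos ht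
  have dm₀ (t : ℝ) (ht : 0 < t) : HasDerivAt m₀ (-m₁ t) t :=
    hasDerivAt_gigMoment_right measurable_id hν 0 one_pos ht
  have dn (t : ℝ) (ht : 0 < t) : HasDerivAt n (-n₀ t) t :=
    hasDerivAt_gigMoment_right measurable_id hν' (-1) one_pos ht
  have dn₀ (t : ℝ) (ht : 0 < t) : HasDerivAt n₀ (-n₁ t) t :=
    hasDerivAt_gigMoment_right measurable_id hν' 0 one_pos ht
  have hlin (t : ℝ) (ht : 0 < t) : 0 < c * t + e := by positivity
  set w : ℝ → ℝ := fun t => m t * n₀ t - n t * m₀ t with hw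
  have dw (t : ℝ) (ht : 0 < t) : HasDerivAt w (n t * m₁ t - m t * n₁ t) t := by
    refine (((dm t ht).mul (dn₀ t ht)).sub ((dn t ht).mul (dm₀ t ht))).congr_deriv ?_
    ring
  have dφ (t : ℝ) (ht : 0 < t) : HasDerivAt (fun t => w t * (c * t + e) ^ (-(1 / c))) 0 t := by
    have h1 := (((hasDerivAt_id t).const_mul c).add_const e).rpow_const (p := -(1 / c))
      (Or.inl (hlin t ht).ne')
    refine ((dw t ht).mul h1).congr_deriv ?_
    have e1 : (c * t + e) * (n t * m₁ t - m t * n₁ t) = w t := by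
      have r1 := h 1 t one_pos ht
      have r2 := h' 1 t one_pos ht
      simp only [hw, hm, hn, hm₀, hn₀, hm₁, hn₁]
      linear_combination gigMoment ν id (-1) 1 t * r2 - gigMoment ν' id (-1) 1 t * r1
    simp only [id, mul_one]
    rw [rpow_sub_one (hlin t ht).ne', ← e1]
    have := (hlin t ht).ne'
    field_simp
    ring
  have hw0 (t : ℝ) (ht : 0 < t) : w t = 0 := by
    have hbd (u : ℝ) (hu : 1 ≤ u) : |w u| ≤ m 1 * n₀ 1 + n 1 * m₀ 1 := by
      have hu0 : 0 < u := by linarith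
      have a1 : m u ≤ m 1 := gigMoment_antitone measurable_id hν _ one_pos one_pos hu
      have a2 : m₀ u ≤ m₀ 1 := gigMoment_antitone measurable_id hν _ one_pos one_pos hu
      have a3 : n u ≤ n 1 := gigMoment_antitone measurable_id hν' _ one_pos one_pos hu
      have a4 : n₀ u ≤ n₀ 1 := gigMoment_antitone measurable_id hν' _ one_pos one_pos hu
      have b1 : 0 < m u := pos _ hu0
      have b2 : 0 < m₀ u := pos _ hu0
      have b3 : 0 < n u := pos' _ hu0
      have b4 : 0 < n₀ u := pos' _ hu0
      have c1 : m u * n₀ u ≤ m 1 * n₀ 1 := mul_le_mul a1 a4 b4.le (b1.le.trans a1)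
      have c2 : n u * m₀ u ≤ n 1 * m₀ 1 := mul_le_mul a3 a2 b2.le (b3.le.trans a3)
      rw [abs_le]
      constructor <;> nlinarith [mul_pos b1 b4, mul_pos b3 b2]
    have hlim : Tendsto (fun u : ℝ => w u * (c * u + e) ^ (-(1 / c))) atTop (nhds 0) := by
      have h1 : Tendsto (fun u : ℝ => (c * u + e) ^ (-(1 / c))) atTop (nhds 0) :=
        (tendsto_rpow_neg_atTop (by positivity)).comp
          (tendsto_atTop_add_const_right _ _ (tendsto_id.const_mul_atTop hc))
      refine squeeze_zero_norm' (a := fun u => (m 1 * n₀ 1 + n 1 * m₀ 1) *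
        (c * u + e) ^ (-(1 / c))) ?_ (by simpa using h1.const_mul (m 1 * n₀ 1 + n 1 * m₀ 1))
      filter_upwards [eventually_ge_atTop 1] with u hu
      have := rpow_nonneg (hlin u (by linarith)).le (-(1 / c))
      rw [norm_mul, Real.norm_eq_abs, Real.norm_eq_abs, abs_of_nonneg this]
      exact mul_le_mul_of_nonneg_right (hbd u hu) this
    have hz : w t * (c * t + e) ^ (-(1 / c)) = 0 := by
      refine tendsto_nhds_unique (tendsto_const_nhds.congr' ?_) hlim
      filter_upwards [eventually_gt_atTop 0] with u hu
      exact eq_of_hasDerivAt_zero_Ioi dφ ht hu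
    exact (mul_eq_zero.1 hz).resolve_right (rpow_pos_of_pos (hlin t ht) _).ne'
  have dq (t : ℝ) (ht : 0 < t) : HasDerivAt (fun t => m t / n t) 0 t := by
    refine ((dm t ht).div (dn t ht) (pos' _ ht).ne').congr_deriv ?_
    have := hw0 t ht
    simp only [hw] at this
    rw [show -m₀ t * n t - m t * -n₀ t = 0 by linarith, zero_div]
  refine ⟨m 1 / n 1, div_pos (pos _ one_pos) (pos' _ one_pos), ?_⟩
  set C := m 1 / n 1 with hC
  have hC0 : 0 < C := div_pos (pos _ one_pos) (pos' _ one_pos)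
  have hmn (t : ℝ) (ht : 0 < t) : m t = C * n t := by
    rw [hC, ← eq_of_hasDerivAt_zero_Ioi dq ht one_pos, div_mul_cancel₀ _ (pos' _ ht).ne']
  have rewr (ρ : Measure ℝ) (t : ℝ) :
      ∫ x, x ^ (-1 : ℤ) * exp (-(1 * x⁻¹)) * exp (-(t * x)) ∂ρ = gigMoment ρ id (-1) 1 t := by
    refine integral_congr_ae (Eventually.of_forall fun x => ?_)
    simp only [id]
    rw [mul_assoc, ← exp_add, neg_add]
  have hint (ρ : Measure ℝ) [IsFiniteMeasure ρ] (hρ : ∀ᵐ x ∂ρ, 0 < x) :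
      Integrable (fun x => x ^ (-1 : ℤ) * exp (-(1 * x⁻¹)) * exp (-x)) ρ := by
    refine (integrable_zpow_mul_exp measurable_id hρ (-1) 1 1 one_pos one_pos).congr
      (Eventually.of_forall fun x => ?_)
    simp only [id]
    rw [mul_assoc, ← exp_add, neg_add, one_mul x]
  have hν'' : ∀ᵐ x ∂(ENNReal.ofReal C • ν'), 0 < x := Measure.ae_smul_measure hν' _
  have : IsFiniteMeasure (ENNReal.ofReal C • ν') := Measure.smul_finite ν' (by simp)
  refine ext_of_integral_mul_exp_neg hν hν''
    (w := fun x => x ^ (-1 : ℤ) * exp (-(1 * x⁻¹))) (by fun_prop) (fun x hx => by positivity)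
    (hint _ hν) (hint _ hν'') fun t ht => ?_
  rw [integral_smul_measure, rewr, rewr, ENNReal.toReal_ofReal hC0.le, smul_eq_mul]
  exact hmn t ht

lemma rpow_mul_exp_neg_le {q c : ℝ} (hq : 0 < q) (hc : 0 < c) {z : ℝ} (hz : 0 < z) :
    z ^ q * exp (-(c * z)) ≤ exp (-(q * (1 + Real.log (c / q)))) := by
  have h := Real.log_le_sub_one_of_pos (show 0 < c / q * z by positivity)
  rw [Real.log_mul (by positivity) hz.ne'] at h
  rw [rpow_def_of_pos hz, ← exp_add]
  apply exp_le_exp.2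
  have h2 : q * (c / q * z) = c * z := by field_simp
  nlinarith

lemma rpow_neg_mul_exp_le {p b : ℝ} (hp : 0 < p) (hb : 0 < b) {x : ℝ} (hx : 0 < x) :
    x ^ (-p - 1) * exp (-(b * x⁻¹)) ≤ exp (-((p + 1) * (1 + Real.log (b / (p + 1))))) := by
  have := rpow_mul_exp_neg_le (show 0 < p + 1 by linarith) hb (inv_pos.2 hx)
  rwa [inv_rpow hx.le, ← rpow_neg hx.le, neg_add'] at this

lemma integrable_gigpdf {p a b : ℝ} (hp : 0 < p) (ha : 0 < a) (hb : 0 < b) :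
    Integrable (gigpdf (-p) a b) := by
  have hi : Integrable ((Ioi (0 : ℝ)).indicator fun x =>
      exp (-((p + 1) * (1 + Real.log (b / 2 / (p + 1))))) * exp (-(a / 2) * x)) :=
    (integrable_indicator_iff measurableSet_Ioi).2
      ((exp_neg_integrableOn_Ioi 0 (half_pos ha)).const_mul _)
  refine hi.mono' (measurable_gigpdf _ _ _).aestronglyMeasurable (Eventually.of_forall fun x => ?_)
  rw [Real.norm_eq_abs, abs_of_nonneg (gigpdf_nonneg _ _ _ _)]
  by_cases hx : 0 < x
  · rw [indicator_of_mem (mem_Ioi.2 hx), gigpdf, if_pos hx]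
    have : exp (-(a * x + b / x) / 2) = exp (-(b / 2 * x⁻¹)) * exp (-(a / 2) * x) := by
      rw [← exp_add]
      ring_nf
    rw [this, ← mul_assoc]
    exact mul_le_mul_of_nonneg_right (rpow_neg_mul_exp_le hp (half_pos hb) hx) (exp_pos _).le
  · rw [indicator_of_notMem (by simpa using hx), gigpdf, if_neg hx]

/-- The unnormalized GIG measure. -/
noncomputable def gigMeasure (p a b : ℝ) : Measure ℝ :=
  volume.withDensity fun x => ENNReal.ofReal (gigpdf p a b x)

lemma ae_pos_gigMeasure (p a b : ℝ) : ∀ᵐ x ∂(gigMeasure p a b), 0 < x :=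
  ae_pos_withDensity_ofReal (measurable_gigpdf p a b) fun _ => gigpdf_of_nonpos p a b

lemma isFiniteMeasure_gigMeasure {p a b : ℝ} (hp : 0 < p) (ha : 0 < a) (hb : 0 < b) :
    IsFiniteMeasure (gigMeasure (-p) a b) :=
  isFiniteMeasure_withDensity_ofReal (integrable_gigpdf hp ha hb).2

lemma gigMeasure_ne_zero (p a b : ℝ) : gigMeasure p a b ≠ 0 := by
  intro h
  rw [gigMeasure, withDensity_eq_zero_iff (measurable_gigpdf p a b).ennreal_ofReal.aemeasurable] at h
  have h1 : ∀ᵐ x ∂(volume : Measure ℝ), x ∉ Ioi (0 : ℝ) := by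
    filter_upwards [h] with x hx hx0
    have hx0 : 0 < x := hx0
    have : 0 < gigpdf p a b x := by
      rw [gigpdf, if_pos hx0]
      positivity
    rw [Pi.zero_apply, ENNReal.ofReal_eq_zero] at hx
    linarith
  have h2 : volume (Ioi (0 : ℝ)) = 0 := by
    simpa using measure_eq_zero_iff_ae_notMem.2 h1
  simp at h2

lemma gigMoment_gigMeasure (p a b : ℝ) (k : ℤ) (s t : ℝ) :
    gigMoment (gigMeasure p a b) id k s t =
      ∫ x in Ioi 0, gigpdf p a b x * (x ^ k * exp (-(s * x⁻¹ + t * x))) :=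
  integral_withDensity_ofReal_Ioi (measurable_gigpdf p a b) (gigpdf_nonneg p a b)
    (fun _ => gigpdf_of_nonpos p a b) _

lemma integrableOn_gigpdf_mul {p a b : ℝ} (hp : 0 < p) (ha : 0 < a) (hb : 0 < b) (k : ℤ)
    {s t : ℝ} (hs : 0 < s) (ht : 0 < t) :
    IntegrableOn (fun x => gigpdf (-p) a b x * (x ^ k * exp (-(s * x⁻¹ + t * x)))) (Ioi 0) := by
  have := isFiniteMeasure_gigMeasure hp ha hb
  have h := integrable_zpow_mul_exp measurable_id (ae_pos_gigMeasure (-p) a b) k s t hs ht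
  rw [gigMeasure, integrable_withDensity_iff (measurable_gigpdf _ _ _).ennreal_ofReal
    (by simp)] at h
  refine h.integrableOn.congr_fun (fun x _ => ?_) measurableSet_Ioi
  simp only [id]
  rw [ENNReal.toReal_ofReal (gigpdf_nonneg _ _ _ _), mul_comm]

/-- Integration by parts for the GIG density. -/
lemma gigMoment_gigMeasure_relation {p a b : ℝ} (hp : 0 < p) (ha : 0 < a) (hb : 0 < b)
    {s t : ℝ} (hs : 0 < s) (ht : 0 < t) :
    (s + b / 2) * gigMoment (gigMeasure (-p) a b) id (-1) s t =
      (t + a / 2) * gigMoment (gigMeasure (-p) a b) id 1 s t +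
        p * gigMoment (gigMeasure (-p) a b) id 0 s t := by
  simp only [gigMoment_gigMeasure]
  have i (k : ℤ) := integrableOn_gigpdf_mul hp ha hb k hs ht
  set f : ℝ → ℝ := fun x => x ^ (-p) * exp (-((s + b / 2) * x⁻¹ + (t + a / 2) * x)) with hf
  set f' : ℝ → ℝ := fun x =>
    (s + b / 2) * (gigpdf (-p) a b x * (x ^ (-1 : ℤ) * exp (-(s * x⁻¹ + t * x)))) -
      (t + a / 2) * (gigpdf (-p) a b x * (x ^ (1 : ℤ) * exp (-(s * x⁻¹ + t * x)))) -
      p * (gigpdf (-p) a b x * (x ^ (0 : ℤ) * exp (-(s * x⁻¹ + t * x)))) with hf'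
  have hf0 : f 0 = 0 := by
    simp only [hf]
    rw [zero_rpow (by linarith), zero_mul]
  have hcont : ContinuousWithinAt f (Ici 0) 0 := by
    rw [ContinuousWithinAt, hf0]
    refine squeeze_zero' (g := fun x =>
      exp (-((p + 1) * (1 + Real.log ((s + b / 2) / (p + 1))))) * x) ?_ ?_ ?_
    · filter_upwards [self_mem_nhdsWithin] with x hx
      have : 0 ≤ x := hx
      simp only [hf]
      positivity
    · filter_upwards [self_mem_nhdsWithin] with x hx
      rcases (mem_Ici.1 hx).eq_or_lt with h0 | h0
      · rw [← h0, hf0, mul_zero]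
      · have h1 := rpow_neg_mul_exp_le hp (show 0 < s + b / 2 by linarith) h0
        have h2 : exp (-((t + a / 2) * x)) ≤ 1 := by
          rw [exp_le_one_iff]
          nlinarith
        have h3 : x ^ (-p) = x ^ (-p - 1) * x := by
          rw [rpow_sub_one h0.ne', div_mul_cancel₀ _ h0.ne']
        simp only [hf]
        rw [neg_add, exp_add, h3]
        calc _ = x ^ (-p - 1) * exp (-((s + b / 2) * x⁻¹)) * x * exp (-((t + a / 2) * x)) := by
              ring
          _ ≤ _ * x * 1 := by gcongr
          _ = _ := mul_one _
    · have : Continuous fun x : ℝ =>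
          exp (-((p + 1) * (1 + Real.log ((s + b / 2) / (p + 1))))) * x := by fun_prop
      simpa using (this.tendsto 0).mono_left nhdsWithin_le_nhds
  have hderiv : ∀ x ∈ Ioi (0 : ℝ), HasDerivAt f (f' x) x := by
    intro x hx
    have hx : 0 < x := hx
    have h1 := Real.hasDerivAt_rpow_const (p := -p) (Or.inl hx.ne')
    have h2 := ((((hasDerivAt_inv hx.ne').const_mul (s + b / 2)).add
      ((hasDerivAt_id x).const_mul (t + a / 2))).neg).exp
    refine (h1.mul h2).congr_deriv ?_
    have h3 : exp (-(a * x + b / x) / 2) * exp (-(s * x⁻¹ + t * x)) =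
        exp (-((s + b / 2) * x⁻¹ + (t + a / 2) * x)) := by
      rw [← exp_add]
      ring_nf
    have h4 : x ^ (-p) = x ^ (-p - 1) * x := by
      rw [rpow_sub_one hx.ne', div_mul_cancel₀ _ hx.ne']
    simp only [hf', gigpdf, if_pos hx, id, Pi.add_apply, Pi.neg_apply]
    rw [h4, ← h3, zpow_neg_one, zpow_one, zpow_zero]
    field_simp
    ring
  have hint : IntegrableOn f' (Ioi 0) :=
    (((i (-1)).const_mul _).sub ((i 1).const_mul _)).sub ((i 0).const_mul _)
  have hlim : Tendsto f atTop (nhds 0) := by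
    refine squeeze_zero' ?_ ?_ (tendsto_rpow_neg_atTop hp)
    · filter_upwards [eventually_gt_atTop 0] with x hx
      positivity
    · filter_upwards [eventually_gt_atTop 0] with x hx
      have h1 : exp (-((s + b / 2) * x⁻¹ + (t + a / 2) * x)) ≤ 1 := by
        rw [exp_le_one_iff, neg_nonpos]
        positivity
      exact mul_le_of_le_one_right (by positivity) h1
  have key := integral_Ioi_of_hasDerivAt_of_tendsto hcont hderiv hint hlim
  have j : IntegrableOn (fun x =>
      (s + b / 2) * (gigpdf (-p) a b x * (x ^ (-1 : ℤ) * exp (-(s * x⁻¹ + t * x)))) -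
      (t + a / 2) * (gigpdf (-p) a b x * (x ^ (1 : ℤ) * exp (-(s * x⁻¹ + t * x))))) (Ioi 0) :=
    ((i (-1)).const_mul _).sub ((i 1).const_mul _)
  rw [hf0, hf', integral_sub j ((i 0).const_mul _),
    integral_sub ((i (-1)).const_mul _) ((i 1).const_mul _), integral_const_mul,
    integral_const_mul, integral_const_mul] at key
  linarith

lemma gigMoment_map {α : Type*} [MeasurableSpace α] {P : Measure α} {X : α → ℝ}
    (hX : Measurable X) (k : ℤ) (s t : ℝ) :
    gigMoment (P.map X) id k s t = gigMoment P X k s t := by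
  unfold gigMoment
  rw [integral_map hX.aemeasurable (Measurable.aestronglyMeasurable (by fun_prop))]
  rfl

lemma laplaceMoment_zero_factorization {Ω : Type*} [MeasurableSpace Ω] {μ : Measure Ω}
    {X Y : Ω → ℝ} (hX : Measurable X) (hY : Measurable Y) (hXpos : ∀ᵐ ω ∂μ, 0 < X ω)
    (hYpos : ∀ᵐ ω ∂μ, 0 < Y ω) (hXY : IndepFun X Y μ)
    (hUV : IndepFun (fun ω => 1 / (X ω + Y ω)) (fun ω => 1 / X ω - 1 / (X ω + Y ω)) μ)
    (s t : ℝ) :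
    gigMoment μ X 0 s t * laplaceMoment μ Y 0 t =
      gigMoment μ (fun ω => 1 / (X ω + Y ω)) 0 t s *
        laplaceMoment μ (fun ω => 1 / X ω - 1 / (X ω + Y ω)) 0 s := by
  have h {A B : Ω → ℝ} (hA : Measurable A) (hB : Measurable B) (hAB : IndepFun A B μ)
      (s t : ℝ) : gigMoment μ A 0 s t * laplaceMoment μ B 0 t =
        ∫ ω, exp (-(s * (A ω)⁻¹ + t * A ω)) * exp (-(t * B ω)) ∂μ := by
    unfold gigMoment laplaceMoment
    have := (hAB.comp (φ := fun x => exp (-(s * x⁻¹ + t * x))) (ψ := fun y => exp (-(t * y)))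
      (by fun_prop) (by fun_prop)).integral_fun_mul_eq_mul_integral
      (Measurable.aestronglyMeasurable (by fun_prop))
      (Measurable.aestronglyMeasurable (by fun_prop))
    simpa [Function.comp_def] using this.symm
  rw [h hX hY hXY, h (by fun_prop) (by fun_prop) hUV]
  refine integral_congr_ae ?_
  filter_upwards [hXpos, hYpos] with ω h1 h2
  rw [← exp_add, ← exp_add]
  congr 1
  field_simp
  ring

theorem exists_hasLaw_of_indepFun {Ω : Type*} [MeasurableSpace Ω] {μ : Measure Ω}
    [IsProbabilityMeasure μ] {X Y : Ω → ℝ} (hX : Measurable X) (hY : Measurable Y)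
    (hXpos : ∀ᵐ ω ∂μ, 0 < X ω) (hYpos : ∀ᵐ ω ∂μ, 0 < Y ω)
    (hYnd : ¬ ∃ c : ℝ, ∀ᵐ ω ∂μ, Y ω = c) (hXY : IndepFun X Y μ)
    (hUV : IndepFun (fun ω => 1 / (X ω + Y ω)) (fun ω => 1 / X ω - 1 / (X ω + Y ω)) μ) :
    ∃ p a b : ℝ, 0 < p ∧ 0 < a ∧ 0 < b ∧
      HasLawGIG μ X (-p) a b ∧ HasLawGamma μ Y p (a / 2) := by
  have hVm : Measurable fun ω => 1 / X ω - 1 / (X ω + Y ω) := by fun_prop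
  have hV0 : ∀ᵐ ω ∂μ, 0 < 1 / X ω - 1 / (X ω + Y ω) := by
    filter_upwards [hXpos, hYpos] with ω h1 h2
    exact sub_pos.2 (one_div_lt_one_div_of_lt h1 (by linarith))
  obtain ⟨c, d, e, hc, hd, he, hV, hY', hX'⟩ := exists_affine_of_factorization hX hY
    (U := fun ω => 1 / (X ω + Y ω)) (by fun_prop) hVm hXpos hYpos
    (by filter_upwards [hXpos, hYpos] with ω h1 h2; positivity) hV0 hYnd
    fun s t _ _ => laplaceMoment_zero_factorization hX hY hXpos hYpos hXY hUV s t
  obtain ⟨he, hLY⟩ := laplaceMoment_zero_eq hY hYpos hc he hY'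
  have hd := (laplaceMoment_zero_eq hVm hV0 hc hd hV).1
  have hp : 0 < 1 / c := by positivity
  have ha : 0 < 2 * e / c := by positivity
  have hb : 0 < 2 * d / c := by positivity
  refine ⟨1 / c, 2 * e / c, 2 * d / c, hp, ha, hb, ?_, ?_⟩
  · have := isFiniteMeasure_gigMeasure hp ha hb
    have : NeZero (gigMeasure (-(1 / c)) (2 * e / c) (2 * d / c)) := ⟨gigMeasure_ne_zero _ _ _⟩
    have := Measure.isProbabilityMeasure_map (μ := μ) hX.aemeasurable
    obtain ⟨C, hC, h⟩ := exists_eq_smul_of_moment_relation (ν := μ.map X)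
      ((ae_map_iff hX.aemeasurable measurableSet_Ioi).2 hXpos) (ae_pos_gigMeasure _ _ _) hc he
      (d := d) (fun s t hs ht => by simpa only [gigMoment_map hX] using hX' s t hs ht)
      (fun s t hs ht => by
        have := gigMoment_gigMeasure_relation hp ha hb hs ht
        field_simp at this
        convert this using 2; ring_nf)
    refine ⟨C, hC, ?_⟩
    rw [h, gigMeasure, ← withDensity_smul _ (measurable_gigpdf _ _ _).ennreal_ofReal]
    congr 1
    ext x
    simp [ENNReal.ofReal_mul hC.le]
  · refine hasLawGamma_of_laplaceMoment hY hYpos hp (by positivity) fun t ht => ?_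
    rw [hLY t ht]
    congr 1
    field_simp

lemma lintegral_Ioi_inv (f : ℝ → ENNReal) :
    ∫⁻ x in Ioi 0, f x = ∫⁻ t in Ioi 0, ENNReal.ofReal ((t ^ 2)⁻¹) * f t⁻¹ := by
  have himg : (fun t : ℝ => t⁻¹) '' Ioi 0 = Ioi 0 := by
    ext x
    constructor
    · rintro ⟨t, ht, rfl⟩
      exact inv_pos.2 (mem_Ioi.1 ht)
    · exact fun hx => ⟨x⁻¹, inv_pos.2 (mem_Ioi.1 hx), inv_inv x⟩
  have h := lintegral_image_eq_lintegral_abs_deriv_mul (f := fun t : ℝ => t⁻¹)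
    (f' := fun t => -(t ^ 2)⁻¹) (s := Ioi 0) measurableSet_Ioi
    (fun t ht => (hasDerivAt_inv (mem_Ioi.1 ht).ne').hasDerivWithinAt) (inv_injective.injOn) f
  rw [himg] at h
  rw [h]
  refine lintegral_congr fun t => ?_
  rw [abs_neg, abs_of_nonneg (by positivity)]

lemma lintegral_Ioi_zero_eq_sub (f : ℝ → ENNReal) {x : ℝ} (hx : 0 < x) :
    ∫⁻ y in Ioi 0, f y = ∫⁻ z in Ioi 0, (Ioi x).indicator (fun z => f (z - x)) z := by
  rw [lintegral_indicator measurableSet_Ioi, Measure.restrict_restrict measurableSet_Ioi,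
    inter_eq_left.2 (Ioi_subset_Ioi hx.le), ← lintegral_indicator measurableSet_Ioi,
    ← lintegral_indicator measurableSet_Ioi, ← lintegral_sub_right_eq_self _ x]
  refine lintegral_congr fun z => ?_
  simp [indicator]

/-- Change of variables `(x, y) ↦ (1 / (x + y), 1 / x - 1 / (x + y))` in an iterated integral. -/
lemma lintegral_lintegral_matsumotoYor {K : ℝ → ℝ → ENNReal}
    (hK : Measurable (Function.uncurry K)) :
    ∫⁻ x in Ioi 0, ∫⁻ y in Ioi 0, K x y =
      ∫⁻ u in Ioi 0, ∫⁻ v in Ioi 0, ENNReal.ofReal ((u ^ 2)⁻¹) *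
        (ENNReal.ofReal (((v + u) ^ 2)⁻¹) * K (v + u)⁻¹ (u⁻¹ - (v + u)⁻¹)) := by
  have hK' {β : Type} [MeasurableSpace β] {f g : β → ℝ} (hf : Measurable f) (hg : Measurable g) :
      Measurable fun b => K (f b) (g b) := hK.comp (hf.prodMk hg)
  have key (t u : ℝ) (ht : 0 < t) (hu : 0 < u) :
      (Ioi t⁻¹).indicator (fun z => K t⁻¹ (z - t⁻¹)) u⁻¹ =
        (Ioi u).indicator (fun t => K t⁻¹ (u⁻¹ - t⁻¹)) t := by
    simp only [indicator, mem_Ioi, inv_lt_inv₀ ht hu]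
  calc
    ∫⁻ x in Ioi 0, ∫⁻ y in Ioi 0, K x y
      = ∫⁻ x in Ioi 0, ∫⁻ u in Ioi 0, ENNReal.ofReal ((u ^ 2)⁻¹) *
          (Ioi x).indicator (fun z => K x (z - x)) u⁻¹ := by
        refine setLIntegral_congr_fun measurableSet_Ioi fun x hx => ?_
        rw [lintegral_Ioi_zero_eq_sub _ (mem_Ioi.1 hx), lintegral_Ioi_inv]
    _ = ∫⁻ t in Ioi 0, ∫⁻ u in Ioi 0, ENNReal.ofReal ((t ^ 2)⁻¹) *
          (ENNReal.ofReal ((u ^ 2)⁻¹) *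
            (Ioi u).indicator (fun t => K t⁻¹ (u⁻¹ - t⁻¹)) t) := by
        rw [lintegral_Ioi_inv]
        refine setLIntegral_congr_fun measurableSet_Ioi fun t ht => ?_
        rw [← lintegral_const_mul' _ _ ENNReal.ofReal_ne_top]
        refine setLIntegral_congr_fun measurableSet_Ioi fun u hu => ?_
        rw [key t u ht hu]
    _ = ∫⁻ u in Ioi 0, ∫⁻ t in Ioi 0, ENNReal.ofReal ((t ^ 2)⁻¹) *
          (ENNReal.ofReal ((u ^ 2)⁻¹) *
            (Ioi u).indicator (fun t => K t⁻¹ (u⁻¹ - t⁻¹)) t) := by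
        refine lintegral_lintegral_swap (Measurable.aemeasurable ?_)
        have h : Measurable fun q : ℝ × ℝ =>
            {q : ℝ × ℝ | q.2 < q.1}.indicator (fun q => K q.1⁻¹ (q.2⁻¹ - q.1⁻¹)) q :=
          (hK' (by fun_prop) (by fun_prop)).indicator
            (measurableSet_lt measurable_snd measurable_fst)
        have h' : (fun q : ℝ × ℝ => (Ioi q.2).indicator (fun t => K t⁻¹ (q.2⁻¹ - t⁻¹)) q.1) =
            fun q : ℝ × ℝ =>
              {q : ℝ × ℝ | q.2 < q.1}.indicator (fun q => K q.1⁻¹ (q.2⁻¹ - q.1⁻¹)) q := rfl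
        rw [← h'] at h
        exact Measurable.mul (by fun_prop) (Measurable.mul (by fun_prop) h)
    _ = _ := by
        refine setLIntegral_congr_fun measurableSet_Ioi fun u hu => ?_
        symm
        rw [lintegral_Ioi_zero_eq_sub _ (mem_Ioi.1 hu)]
        refine setLIntegral_congr_fun measurableSet_Ioi fun t ht => ?_
        by_cases h : u < t
        · simp [h, mul_left_comm]
        · simp [h]

lemma gigpdf_mul_gampdf {p a b u v : ℝ} (hu : 0 < u) (hv : 0 < v) :
    (u ^ 2)⁻¹ * (((v + u) ^ 2)⁻¹ * (gigpdf (-p) a b (v + u)⁻¹ *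
      gampdf p (a / 2) (u⁻¹ - (v + u)⁻¹))) = gigpdf (-p) b a u * gampdf p (b / 2) v := by
  have hw : 0 < v + u := by positivity
  have hy : u⁻¹ - (v + u)⁻¹ = v / (u * (v + u)) := by field_simp; ring
  have hy0 : 0 < v / (u * (v + u)) := by positivity
  have hsq {z : ℝ} (hz : 0 < z) : (z ^ 2)⁻¹ = exp (-(2 * log z)) := by
    rw [exp_neg, mul_comm, exp_mul, exp_log hz]
    norm_cast
  rw [hy, gigpdf, gigpdf, gampdf, gampdf, if_pos hu, if_pos hv, if_pos (inv_pos.2 hw),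
    if_pos hy0, hsq hu, hsq hw]
  simp only [rpow_def_of_pos hu, rpow_def_of_pos hv, rpow_def_of_pos (inv_pos.2 hw),
    rpow_def_of_pos hy0, ← exp_add, log_inv, log_div hv.ne' (mul_pos hu hw).ne',
    log_mul hu.ne' hw.ne']
  congr 1
  field_simp
  ring

lemma lintegral_withDensity_ofReal_Ioi {g : ℝ → ℝ} (hg : Measurable g) (hg0 : ∀ x ≤ 0, g x = 0)
    (F : ℝ → ENNReal) : ∫⁻ x, F x ∂(volume.withDensity fun x => ENNReal.ofReal (g x)) =
      ∫⁻ x in Ioi 0, ENNReal.ofReal (g x) * F x := by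
  rw [lintegral_withDensity_eq_lintegral_mul_non_measurable _ hg.ennreal_ofReal
    (Eventually.of_forall fun _ => ENNReal.ofReal_lt_top), ← lintegral_indicator measurableSet_Ioi]
  refine lintegral_congr fun x => ?_
  by_cases hx : 0 < x
  · simp [hx]
  · simp [hx, hg0 x (not_lt.1 hx)]

theorem indepFun_of_hasLaw {Ω : Type*} [MeasurableSpace Ω] {μ : Measure Ω}
    [IsProbabilityMeasure μ] {X Y : Ω → ℝ} (hX : Measurable X) (hY : Measurable Y)
    (hXY : IndepFun X Y μ) {p a b : ℝ} (hXlaw : HasLawGIG μ X (-p) a b)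
    (hYlaw : HasLawGamma μ Y p (a / 2)) :
    IndepFun (fun ω => 1 / (X ω + Y ω)) (fun ω => 1 / X ω - 1 / (X ω + Y ω)) μ := by
  obtain ⟨k, hk, hXlaw⟩ := hXlaw
  obtain ⟨l, hl, hYlaw⟩ := hYlaw
  have hf : Measurable fun x => ENNReal.ofReal (k * gigpdf (-p) a b x) :=
    ((measurable_gigpdf _ _ _).const_mul k).ennreal_ofReal
  have hg : Measurable fun y => ENNReal.ofReal (l * gampdf p (a / 2) y) :=
    ((measurable_gampdf _ _).const_mul l).ennreal_ofReal
  have hfb : Measurable fun u => ENNReal.ofReal (k * gigpdf (-p) b a u) :=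
    ((measurable_gigpdf _ _ _).const_mul k).ennreal_ofReal
  have hgb : Measurable fun v => ENNReal.ofReal (l * gampdf p (b / 2) v) :=
    ((measurable_gampdf _ _).const_mul l).ennreal_ofReal
  have hUm : Measurable fun ω => 1 / (X ω + Y ω) := by fun_prop
  have hVm : Measurable fun ω => 1 / X ω - 1 / (X ω + Y ω) := by fun_prop
  set A : Set ℝ → ENNReal := fun S => ∫⁻ u in Ioi 0,
    ENNReal.ofReal (k * gigpdf (-p) b a u) * S.indicator 1 u with hA
  set B : Set ℝ → ENNReal := fun T => ∫⁻ v in Ioi 0,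
    ENNReal.ofReal (l * gampdf p (b / 2) v) * T.indicator 1 v with hB
  have key {S T : Set ℝ} (hS : MeasurableSet S) (hT : MeasurableSet T) :
      μ ((fun ω => 1 / (X ω + Y ω)) ⁻¹' S ∩ (fun ω => 1 / X ω - 1 / (X ω + Y ω)) ⁻¹' T) =
        A S * B T := by
    have hφ : Measurable fun q : ℝ × ℝ => S.indicator (1 : ℝ → ENNReal) (1 / (q.1 + q.2)) *
        T.indicator (1 : ℝ → ENNReal) (1 / q.1 - 1 / (q.1 + q.2)) :=
      ((measurable_one.indicator hS).comp (by fun_prop)).mul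
        ((measurable_one.indicator hT).comp (by fun_prop))
    have h1 : μ ((fun ω => 1 / (X ω + Y ω)) ⁻¹' S ∩
        (fun ω => 1 / X ω - 1 / (X ω + Y ω)) ⁻¹' T) =
        ∫⁻ q, S.indicator (1 : ℝ → ENNReal) (1 / (q.1 + q.2)) *
          T.indicator (1 : ℝ → ENNReal) (1 / q.1 - 1 / (q.1 + q.2))
          ∂(μ.map fun ω => (X ω, Y ω)) := by
      rw [lintegral_map hφ (hX.prodMk hY), ← lintegral_indicator_one ((hUm hS).inter (hVm hT))]
      refine lintegral_congr fun ω => ?_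
      simp only [inter_indicator_one, Pi.mul_apply]
      rfl
    have := Measure.isProbabilityMeasure_map (μ := μ) hX.aemeasurable
    have := Measure.isProbabilityMeasure_map (μ := μ) hY.aemeasurable
    rw [h1, hXY.map_prod_eq_prod_map_map hX.aemeasurable hY.aemeasurable,
      lintegral_prod _ hφ.aemeasurable, hXlaw, hYlaw]
    simp only [lintegral_withDensity_ofReal_Ioi ((measurable_gampdf p (a / 2)).const_mul l)
      fun y hy => by rw [gampdf_of_nonpos _ _ hy, mul_zero]]
    rw [lintegral_withDensity_ofReal_Ioi ((measurable_gigpdf (-p) a b).const_mul k)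
      fun x hx => by rw [gigpdf_of_nonpos _ _ _ hx, mul_zero]]
    simp only [← lintegral_const_mul' _ _ ENNReal.ofReal_ne_top]
    rw [lintegral_lintegral_matsumotoYor, hA, hB]
    · simp only
      rw [← lintegral_mul_const'']
      · refine setLIntegral_congr_fun measurableSet_Ioi fun u hu => ?_
        rw [← lintegral_const_mul'']
        · refine setLIntegral_congr_fun measurableSet_Ioi fun v hv => ?_
          have hu : 0 < u := hu
          have hv : 0 < v := hv
          have h1 : 1 / ((v + u)⁻¹ + (u⁻¹ - (v + u)⁻¹)) = u := by simp
          have h2 : 1 / (v + u)⁻¹ - u = v := by simp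
          simp only [h1, h2]
          have h := congrArg (fun z => ENNReal.ofReal (k * l * z))
            (gigpdf_mul_gampdf (p := p) (a := a) (b := b) hu hv)
          have h3 : k * l * (gigpdf (-p) b a u * gampdf p (b / 2) v) =
            (k * gigpdf (-p) b a u) * (l * gampdf p (b / 2) v) := by ring
          have h4 : k * l * ((u ^ 2)⁻¹ * (((v + u) ^ 2)⁻¹ * (gigpdf (-p) a b (v + u)⁻¹ *
              gampdf p (a / 2) (u⁻¹ - (v + u)⁻¹)))) = (u ^ 2)⁻¹ * (((v + u) ^ 2)⁻¹ *
              ((k * gigpdf (-p) a b (v + u)⁻¹) *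
                (l * gampdf p (a / 2) (u⁻¹ - (v + u)⁻¹)))) := by ring
          simp only [h3, h4] at h
          rw [ENNReal.ofReal_mul (by positivity), ENNReal.ofReal_mul (by positivity),
            ENNReal.ofReal_mul (mul_nonneg hk.le (gigpdf_nonneg _ _ _ _)),
            ENNReal.ofReal_mul (mul_nonneg hk.le (gigpdf_nonneg _ _ _ _))] at h
          rw [mul_mul_mul_comm, ← h]
          ring
        · exact (hgb.mul (measurable_one.indicator hT)).aemeasurable
      · exact (hfb.mul (measurable_one.indicator hS)).aemeasurable
    · exact (hf.comp measurable_fst).mul ((hg.comp measurable_snd).mul hφ)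
  have hAB : A univ * B univ = 1 := by
    rw [← key MeasurableSet.univ MeasurableSet.univ]
    simp
  rw [indepFun_iff_measure_inter_preimage_eq_mul]
  intro S T hS hT
  have hU := key hS MeasurableSet.univ
  have hV := key MeasurableSet.univ hT
  rw [preimage_univ, inter_univ] at hU
  rw [preimage_univ, univ_inter] at hV
  rw [key hS hT, hU, hV, mul_mul_mul_comm, mul_comm (B univ), mul_mul_mul_comm, hAB, mul_one]

/-- Letac–Wesołowski: for independent, positive, non-Dirac `X` and `Y`, the random variables
`U = 1/(X+Y)` and `V = 1/X - 1/(X+Y)` are independent iff there are `p, a, b > 0` with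
`X ~ GIG(-p, a, b)` and `Y ~ Γ(p, a/2)`. -/
theorem matsumoto_yor_characterization
    {Ω : Type*} [MeasurableSpace Ω] (μ : Measure Ω) [IsProbabilityMeasure μ]
    (X Y : Ω → ℝ) (hXm : Measurable X) (hYm : Measurable Y)
    (hXpos : ∀ᵐ ω ∂μ, 0 < X ω) (hYpos : ∀ᵐ ω ∂μ, 0 < Y ω)
    (hXnd : ¬ ∃ c : ℝ, ∀ᵐ ω ∂μ, X ω = c) (hYnd : ¬ ∃ c : ℝ, ∀ᵐ ω ∂μ, Y ω = c)
    (hindep : IndepFun X Y μ) :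
    IndepFun (fun ω => 1 / (X ω + Y ω)) (fun ω => 1 / X ω - 1 / (X ω + Y ω)) μ ↔
      ∃ p a b : ℝ, 0 < p ∧ 0 < a ∧ 0 < b ∧
        HasLawGIG μ X (-p) a b ∧ HasLawGamma μ Y p (a / 2) := by
  exact ⟨fun h => exists_hasLaw_of_indepFun hXm hYm hXpos hYpos hYnd hindep h,
    fun ⟨_, _, _, _, _, _, hX, hY⟩ => indepFun_of_hasLaw hXm hYm hindep hX hY⟩
end
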